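/- arXiv:2311.00609 — 2 statements merged into one kernel-verified Lean document; each statement's English description precedes it below -/
import Mathlib

section
/- Let T = Th(ℚ, cyc)^eq. In a monster model of T, let a, d₁, d₂ be three distinct elements of the home sort O with cyc(d₁, a, d₂), and let b = q(d₁, d₂). Then a ⫝d_∅ b, but a does not satisfy a ⫝d_∅ acl(b). Hence dividing independence fails algebraic extension over ∅ in T. -/
open FirstOrder FirstOrder.Language Set Cardinal

universe u v w x

namespace PaperDiv

variable (L : FirstOrder.Language.{u, v}) (M : Type w) [L.Structure M]

/-- Two (possibly infinite) tuples have the same complete type over the parameter set `C`. -/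
def SameType (C : Set M) {ι : Type x} (a b : ι → M) : Prop :=
  ∀ (n : ℕ) (φ : L.Formula (ι ⊕ Fin n)) (c : Fin n → M),
    (∀ i, c i ∈ C) → (φ.Realize (Sum.elim a c) ↔ φ.Realize (Sum.elim b c))

/-- The model-theoretic algebraic closure of a set `C`. -/
def acl (C : Set M) : Set M :=
  {a | ∃ (n : ℕ) (φ : L.Formula (Fin (n + 1))) (c : Fin n → M),
    (∀ i, c i ∈ C) ∧ φ.Realize (Fin.cons a c) ∧ {x : M | φ.Realize (Fin.cons x c)}.Finite}

/-- A sequence of `ι`-tuples is indiscernible over `C`. -/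
def Indiscernible (C : Set M) {ι : Type x} (b : ℕ → ι → M) : Prop :=
  ∀ (n : ℕ) (s t : Fin n → ℕ), StrictMono s → StrictMono t →
    SameType L M C (fun p : Fin n × ι => b (s p.1) p.2) (fun p : Fin n × ι => b (t p.1) p.2)

/-- The formula `φ(x, b)` divides over `C`:  there is a `C`-indiscernible sequence starting
with `b` along which the instances of `φ` are `k`-inconsistent. -/
def FormulaDividesOver (C : Set M) {ι : Type x} {m : ℕ}
    (φ : L.Formula (ι ⊕ Fin m)) (b : Fin m → M) : Prop :=
  ∃ (bs : ℕ → Fin m → M) (k : ℕ), 0 < k ∧ bs 0 = b ∧ Indiscernible L M C bs ∧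
    ∀ s : Finset ℕ, s.card = k → ¬∃ x : ι → M, ∀ i ∈ s, φ.Realize (Sum.elim x (bs i))

/-- The complete type of the tuple `a` over the parameter set `B` divides over `C`. -/
def TypeDividesOver (C B : Set M) {ι : Type x} (a : ι → M) : Prop :=
  ∃ (m : ℕ) (φ : L.Formula (ι ⊕ Fin m)) (b : Fin m → M),
    (∀ i, b i ∈ B) ∧ φ.Realize (Sum.elim a b) ∧ FormulaDividesOver L M C φ b

/-- The complete type of the tuple `a` over the parameter set `B` forks over `C`: it implies a
finite disjunction of formulas (with arbitrary parameters), each of which divides over `C`. -/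
def TypeForksOver (C B : Set M) {ι : Type x} (a : ι → M) : Prop :=
  ∃ (N : ℕ) (m : Fin N → ℕ) (φ : ∀ j, L.Formula (ι ⊕ Fin (m j))) (b : ∀ j, Fin (m j) → M),
    (∀ j, FormulaDividesOver L M C (φ j) (b j)) ∧
    ∀ x : ι → M, SameType L M B x a → ∃ j, (φ j).Realize (Sum.elim x (b j))

/-- Dividing independence: `A ⫝d_C B`, i.e. `tp(A/BC)` does not divide over `C`. -/
def dind (A C B : Set M) : Prop :=
  ¬TypeDividesOver L M C (B ∪ C) (fun x : A => (x : M))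

/-- Forking independence: `A ⫝f_C B`, i.e. `tp(A/BC)` does not fork over `C`. -/
def find (A C B : Set M) : Prop :=
  ¬TypeForksOver L M C (B ∪ C) (fun x : A => (x : M))

/-- Algebraic independence: `A ⫝a_C B`. -/
def aind (A C B : Set M) : Prop :=
  acl L M (A ∪ C) ∩ acl L M (B ∪ C) = acl L M C

/-- M-independence: `A ⫝M_C B`. -/
def Mind (A C B : Set M) : Prop :=
  ∀ D : Set M, C ⊆ D → D ⊆ acl L M (B ∪ C) → aind L M A D B

/-- m-independence: `A ⫝m_C B`. -/
def mind (A C B : Set M) : Prop :=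
  ∀ D : Set M, C ⊆ D → D ⊆ B ∪ C → aind L M A D B

/-- `M` is a monster model (with respect to the cardinal `κ` bounding the "small" sets):
it is strongly `κ`-homogeneous and `κ`-saturated. -/
structure IsMonster (κ : Cardinal.{w}) : Prop where
  aleph0_lt : ℵ₀ < κ
  homogeneous : ∀ (C : Set M) {ι : Type w} (a b : ι → M), #C < κ → #ι < κ →
    SameType L M C a b → ∃ σ : M ≃[L] M, (∀ c ∈ C, σ c = c) ∧ ∀ i, σ (a i) = b i
  saturated : ∀ (C : Set M) {ι : Type w}, #C < κ → #ι < κ →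
    ∀ p : Set ((n : ℕ) × L.Formula (ι ⊕ Fin n) × (Fin n → M)),
      (∀ q ∈ p, ∀ i, q.2.2 i ∈ C) →
      (∀ s : Finset ((n : ℕ) × L.Formula (ι ⊕ Fin n) × (Fin n → M)), ↑s ⊆ p →
        ∃ x : ι → M, ∀ q ∈ s, q.2.1.Realize (Sum.elim x q.2.2)) →
      ∃ x : ι → M, ∀ q ∈ p, q.2.1.Realize (Sum.elim x q.2.2)


/-! ### Properties of abstract ternary relations -/


/-- `ind` is invariant under automorphisms of the monster model. -/
def Invariant (ind : Set M → Set M → Set M → Prop) : Prop :=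
  ∀ (σ : M ≃[L] M) (A C B : Set M), ind A C B → ind (σ '' A) (σ '' C) (σ '' B)

/-- `ind` satisfies monotonicity. -/
def MonotoneRel (ind : Set M → Set M → Set M → Prop) : Prop :=
  ∀ A C B A' B' : Set M, A' ⊆ A → B' ⊆ B → ind A C B → ind A' C B'

/-- `ind` satisfies base monotonicity. -/
def BaseMonotoneRel (ind : Set M → Set M → Set M → Prop) : Prop :=
  ∀ A C B D : Set M, D ⊆ B → ind A C B → ind A (C ∪ D) B

/-- `ind` has algebraic extension over `C`. -/
def AlgebraicExtensionOver (ind : Set M → Set M → Set M → Prop) (C : Set M) : Prop :=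
  ∀ A B : Set M, ind A C B → ind A C (acl L M (B ∪ C))

/-- `ind` has algebraic extension. -/
def AlgebraicExtension (ind : Set M → Set M → Set M → Prop) : Prop :=
  ∀ C : Set M, AlgebraicExtensionOver L M ind C

/-- `ind` preserves algebraic closure. -/
def PreservesAcl (ind : Set M → Set M → Set M → Prop) : Prop :=
  ∀ A B C : Set M,
    (ind A C B ↔ ind (acl L M (A ∪ C)) C B) ∧
    (ind A C B ↔ ind A C (acl L M (B ∪ C))) ∧
    (ind A C B ↔ ind A (acl L M C) B)

/-- Axiom (i): if `A ⫝_C B` then `acl(AC) ⫝_C B`. -/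
def AxiomI (ind : Set M → Set M → Set M → Prop) : Prop :=
  ∀ A B C : Set M, ind A C B → ind (acl L M (A ∪ C)) C B

/-- Axiom (ii): if `A ⫝_{acl(C)} B` then `A ⫝_C B`. -/
def AxiomII (ind : Set M → Set M → Set M → Prop) : Prop :=
  ∀ A B C : Set M, ind A (acl L M C) B → ind A C B

/-! ### The dense circular order with unordered pairs -/

/-- Relation symbols: unary sort predicates `O` (the home sort) and `P` (the sort of unordered
pairs), the circular order `cyc` on the home sort, and the graph of the pairing quotient map
`q : O² → P`. -/
inductive Rel11 : ℕ → Type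
  | O : Rel11 1
  | P : Rel11 1
  | cyc : Rel11 3
  | pair : Rel11 3

/-- The language of the two relevant sorts of `Th(ℚ, cyc)^eq`. -/
abbrev L11 : FirstOrder.Language := ⟨fun _ => Empty, Rel11⟩

/-- The circular order on `ℚ`: `cyc(x,y,z) ⇔ (x<y<z) ∨ (z<x<y) ∨ (y<z<x)`. -/
def cycQ (x y z : ℚ) : Prop := (x < y ∧ y < z) ∨ (z < x ∧ x < y) ∨ (y < z ∧ z < x)

/-- The standard model: the home sort `ℚ` together with the sort of unordered pairs
(and singletons) from `ℚ`, i.e. `Sym2 ℚ`, with the quotient map `q(x,y) = s(x,y)`. -/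
instance U11Structure : L11.Structure (ℚ ⊕ Sym2 ℚ) where
  funMap := fun f _ => f.elim
  RelMap := fun {n} r v =>
    match r with
    | .O => ∃ x : ℚ, v 0 = Sum.inl x
    | .P => ∃ s : Sym2 ℚ, v 0 = Sum.inr s
    | .cyc => ∃ x y z : ℚ, v 0 = Sum.inl x ∧ v 1 = Sum.inl y ∧ v 2 = Sum.inl z ∧ cycQ x y z
    | .pair => ∃ x y : ℚ, v 0 = Sum.inl x ∧ v 1 = Sum.inl y ∧ v 2 = Sum.inr s(x, y)

/-- The complete theory `Th(ℚ, cyc)^eq` (restricted to the two relevant sorts). -/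
def T11 : L11.Theory := L11.completeTheory (ℚ ⊕ Sym2 ℚ)

/-! ### Back-and-forth for the circular order on `ℚ` -/

/-- A finite partial isomorphism between countable dense linear orders without endpoints extends
to an order isomorphism. -/
theorem exists_orderIso_extending {α β : Type*} [LinearOrder α] [LinearOrder β]
    [Countable α] [DenselyOrdered α] [NoMinOrder α] [NoMaxOrder α] [Nonempty α]
    [Countable β] [DenselyOrdered β] [NoMinOrder β] [NoMaxOrder β] [Nonempty β]
    (p : Order.PartialIso α β) : ∃ e : α ≃o β, ∀ c ∈ p.val, e c.1 = c.2 := by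
  cases nonempty_encodable α
  cases nonempty_encodable β
  let D : α ⊕ β → Order.Cofinal (Order.PartialIso α β) := fun c =>
    Sum.recOn c (Order.PartialIso.definedAtLeft β) (Order.PartialIso.definedAtRight α)
  let I : Order.Ideal (Order.PartialIso α β) := Order.idealOfCofinals p D
  let F a := Order.PartialIso.funOfIdeal a I
    (Order.cofinal_meets_idealOfCofinals _ D (Sum.inl a))
  let G b := Order.PartialIso.invOfIdeal b I
    (Order.cofinal_meets_idealOfCofinals _ D (Sum.inr b))
  refine ⟨OrderIso.ofCmpEqCmp (fun a => (F a).val) (fun b => (G b).val) fun a b => ?_,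
    fun c hc => ?_⟩
  · rcases (F a).prop with ⟨f, hf, ha⟩
    rcases (G b).prop with ⟨g, hg, hb⟩
    rcases I.directed _ hf _ hg with ⟨m, _, fm, gm⟩
    exact m.prop (a, _) (fm ha) (_, b) (gm hb)
  · rcases (F c.1).prop with ⟨f, hf, ha⟩
    rcases I.directed _ hf _ (Order.mem_idealOfCofinals p D) with ⟨m, _, fm, pm⟩
    have h := m.prop (c.1, _) (fm ha) c (pm hc)
    rw [cmp_self_eq_eq] at h
    exact (cmp_eq_eq_iff _ _).1 h.symm

/-- `ℚ` without the point `p`, to be ordered by cutting the circular order at `p`. -/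
def Cut (p : ℚ) : Type := {x : ℚ // ¬x = p}

namespace Cut

variable {p : ℚ}

/-- The points above `p` come before the points below `p`. -/
def key (x : Cut p) : Bool ×ₗ ℚ := toLex (decide (x.1 < p), x.1)

theorem key_injective : Function.Injective (key (p := p)) := fun _ _ h =>
  Subtype.ext (congrArg (fun z => (ofLex z).2) h)

noncomputable instance : LinearOrder (Cut p) := LinearOrder.lift' key key_injective

instance : Countable (Cut p) := inferInstanceAs (Countable {x : ℚ // ¬x = p})

theorem lt_iff (x y : Cut p) : x < y ↔ cycQ p x.1 y.1 := by
  change key x < key y ↔ _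
  obtain ⟨x, hx⟩ := x
  obtain ⟨y, hy⟩ := y
  have hx' := lt_or_gt_of_ne hx
  have hy' := lt_or_gt_of_ne hy
  simp only [key, Prod.Lex.toLex_lt_toLex, cycQ, Bool.lt_iff, decide_eq_true_eq,
    decide_eq_false_iff_not, not_lt, decide_eq_decide]
  grind

instance : Nonempty (Cut p) := ⟨⟨p + 1, by simp⟩⟩

instance : NoMaxOrder (Cut p) where
  exists_gt := by
    rintro ⟨x, hx⟩
    rcases lt_or_gt_of_ne hx with h | h
    · obtain ⟨z, h1, h2⟩ := exists_between h
      exact ⟨⟨z, h2.ne⟩, (lt_iff _ _).2 (Or.inr (Or.inr ⟨h1, h2⟩))⟩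
    · obtain ⟨z, h1⟩ := exists_gt x
      exact ⟨⟨z, (h.trans h1).ne'⟩, (lt_iff _ _).2 (Or.inl ⟨h, h1⟩)⟩

instance : NoMinOrder (Cut p) where
  exists_lt := by
    rintro ⟨x, hx⟩
    rcases lt_or_gt_of_ne hx with h | h
    · obtain ⟨z, h1⟩ := exists_lt x
      exact ⟨⟨z, (h1.trans h).ne⟩, (lt_iff _ _).2 (Or.inr (Or.inr ⟨h1, h⟩))⟩
    · obtain ⟨z, h1, h2⟩ := exists_between h
      exact ⟨⟨z, h1.ne'⟩, (lt_iff _ _).2 (Or.inl ⟨h1, h2⟩)⟩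

instance : DenselyOrdered (Cut p) where
  dense := by
    rintro x y hxy
    rw [lt_iff] at hxy
    simp only [lt_iff]
    obtain ⟨x, hx⟩ := x
    obtain ⟨y, hy⟩ := y
    rcases hxy with ⟨h1, h2⟩ | ⟨h1, h2⟩ | ⟨h1, h2⟩
    · obtain ⟨z, h3, h4⟩ := exists_between h2
      exact ⟨⟨z, (h1.trans h3).ne'⟩, Or.inl ⟨h1, h3⟩, Or.inl ⟨h1.trans h3, h4⟩⟩
    · obtain ⟨z, h3⟩ := exists_gt x
      exact ⟨⟨z, (h2.trans h3).ne'⟩, Or.inl ⟨h2, h3⟩, Or.inr (Or.inl ⟨h1, h2.trans h3⟩)⟩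
    · obtain ⟨z, h3, h4⟩ := exists_between h1
      exact ⟨⟨z, (h4.trans h2).ne⟩, Or.inr (Or.inr ⟨h3, h4.trans h2⟩),
        Or.inr (Or.inr ⟨h4, h2⟩)⟩

end Cut

/-- An isomorphism between two cuts of `ℚ` extends to an automorphism of the circular order. -/
theorem exists_cycQ_perm_of_cut {p q : ℚ} (e : Cut p ≃o Cut q) :
    ∃ σ : Equiv.Perm ℚ, (∀ x y z, cycQ (σ x) (σ y) (σ z) ↔ cycQ x y z) ∧ σ p = q ∧
      ∀ x : Cut p, σ x.1 = (e x).1 := by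
  let σ : Equiv.Perm ℚ := Equiv.subtypeCongr (p := (· = p)) (q := (· = q))
    (Equiv.ofUnique {x // x = p} {x // x = q}) e.toEquiv
  have hp : σ p = q := by
    simp only [σ, Equiv.subtypeCongr, Equiv.trans_apply]
    rw [Equiv.sumCompl_symm_apply_of_pos (p := (· = p)) rfl]
    rfl
  have hx : ∀ x : Cut p, σ x.1 = (e x).1 := by
    intro x
    simp only [σ, Equiv.subtypeCongr, Equiv.trans_apply]
    rw [Equiv.sumCompl_symm_apply_of_neg (p := (· = p)) x.2]
    rfl
  refine ⟨σ, ?_, hp, hx⟩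
  have key : ∀ x y, x ≠ p → y ≠ p → (cycQ q (σ x) (σ y) ↔ cycQ p x y) := by
    intro x y h h'
    have hlt : ∀ a b : Cut p, cycQ q (σ a.1) (σ b.1) ↔ cycQ p a.1 b.1 := fun a b => by
      rw [hx, hx, ← Cut.lt_iff, ← Cut.lt_iff, e.lt_iff_lt]
    exact hlt ⟨x, h⟩ ⟨y, h'⟩
  have hne : ∀ x, x ≠ p → σ x ≠ q := fun x h h' => h (σ.injective (h'.trans hp.symm))
  have rot : ∀ x y z, cycQ x y z ↔ cycQ y z x := by
    intro x y z; simp only [cycQ]; grind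
  have cut : ∀ r x y z, x ≠ r → y ≠ r → z ≠ r → (cycQ x y z ↔
      (cycQ r x y ∧ cycQ r y z) ∨ (cycQ r y z ∧ cycQ r z x) ∨ (cycQ r z x ∧ cycQ r x y)) := by
    intro r x y z h1 h2 h3
    simp only [cycQ]; grind
  have irr : ∀ r x, ¬cycQ r r x ∧ ¬cycQ r x r := by
    intro r x; simp only [cycQ]; grind
  have two : ∀ y z, cycQ (σ p) (σ y) (σ z) ↔ cycQ p y z := by
    intro y z
    rw [hp]
    by_cases hy : y = p
    · subst hy; rw [hp]; simp [irr]
    by_cases hz : z = p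
    · subst hz; rw [hp]; simp [irr]
    exact key y z hy hz
  intro x y z
  by_cases h1 : x = p
  · subst h1; exact two y z
  by_cases h2 : y = p
  · subst h2; rw [rot (σ x), rot x]; exact two z x
  by_cases h3 : z = p
  · subst h3; rw [← rot (σ z), ← rot z]; exact two x y
  rw [cut q _ _ _ (hne x h1) (hne y h2) (hne z h3), cut p x y z h1 h2 h3, key x y h1 h2,
    key y z h2 h3, key z x h3 h1]

/-- Two finite tuples of rationals in the same cyclic arrangement are conjugate. -/
theorem exists_cycQ_perm {ι : Type*} [Finite ι] {u : ι → ℕ} (hu : Function.Injective u)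
    {x y : ι → ℚ} (hx : Function.Injective x) (hy : Function.Injective y)
    (hxc : ∀ i j k, u i < u j → u j < u k → cycQ (x i) (x j) (x k))
    (hyc : ∀ i j k, u i < u j → u j < u k → cycQ (y i) (y j) (y k)) :
    ∃ σ : Equiv.Perm ℚ, (∀ r s t, cycQ (σ r) (σ s) (σ t) ↔ cycQ r s t) ∧
      ∀ i, σ (x i) = y i := by
  rcases isEmpty_or_nonempty ι with _ | _
  · exact ⟨Equiv.refl ℚ, fun _ _ _ => Iff.rfl, isEmptyElim⟩
  cases nonempty_fintype ι
  classical
  obtain ⟨o, ho⟩ := Finite.exists_min u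
  let g : {i // i ≠ o} → Cut (x o) × Cut (y o) := fun i =>
    (⟨x i, fun h => i.2 (hx h)⟩, ⟨y i, fun h => i.2 (hy h)⟩)
  have pos : ∀ i : {i // i ≠ o}, u o < u i := fun i =>
    lt_of_le_of_ne (ho i) fun h => i.2 (hu h).symm
  have hlt : ∀ i j : {i // i ≠ o}, u i < u j → (g i).1 < (g j).1 ∧ (g i).2 < (g j).2 :=
    fun i j h => ⟨(Cut.lt_iff _ _).2 (hxc _ _ _ (pos i) h), (Cut.lt_iff _ _).2 (hyc _ _ _ (pos i) h)⟩
  obtain ⟨e, he⟩ := exists_orderIso_extending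
    (⟨Finset.univ.image g, by
      simp only [Finset.mem_image, Finset.mem_univ, true_and]
      rintro _ ⟨i, rfl⟩ _ ⟨j, rfl⟩
      rcases lt_trichotomy (u i) (u j) with h | h | h
      · rw [cmp_eq_lt_iff _ _ |>.2 (hlt i j h).1, cmp_eq_lt_iff _ _ |>.2 (hlt i j h).2]
      · rw [Subtype.ext (hu h), cmp_self_eq_eq, cmp_self_eq_eq]
      · rw [cmp_eq_gt_iff _ _ |>.2 (hlt j i h).1, cmp_eq_gt_iff _ _ |>.2 (hlt j i h).2]⟩ :
      Order.PartialIso (Cut (x o)) (Cut (y o)))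
  obtain ⟨σ, hσ, hσo, hσe⟩ := exists_cycQ_perm_of_cut e
  refine ⟨σ, hσ, fun i => ?_⟩
  by_cases hi : i = o
  · rw [hi, hσo]
  · have h := he (g ⟨i, hi⟩) (Finset.mem_image_of_mem _ (Finset.mem_univ _))
    exact (hσe (g ⟨i, hi⟩).1).trans (congrArg Subtype.val h)

/-! ### Transfer from the standard model -/

section Relations

variable {K : Type*} [L11.Structure K]

/-- Membership in the home sort. -/
def Home (x : K) : Prop := Structure.RelMap (L := L11) Rel11.O ![x]

/-- The circular order. -/
def Cyc (x y z : K) : Prop := Structure.RelMap (L := L11) Rel11.cyc ![x, y, z]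

/-- The graph of the quotient map to unordered pairs. -/
def Pair (x y b : K) : Prop := Structure.RelMap (L := L11) Rel11.pair ![x, y, b]

variable {α : Type*}

/-- The formula defining the home sort. -/
def homeF (i : α) : L11.Formula α := Relations.formula (L := L11) Rel11.O ![Term.var i]

/-- The formula defining the circular order. -/
def cycF (i j k : α) : L11.Formula α :=
  Relations.formula (L := L11) Rel11.cyc ![Term.var i, Term.var j, Term.var k]

/-- The formula defining the graph of the quotient map. -/
def pairF (i j k : α) : L11.Formula α :=
  Relations.formula (L := L11) Rel11.pair ![Term.var i, Term.var j, Term.var k]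

/-- The formula `i = j`. -/
def eqF (i j : α) : L11.Formula α := Term.equal (Term.var i) (Term.var j)

@[simp]
theorem realize_homeF (i : α) (v : α → K) : (homeF i).Realize v ↔ Home (v i) := by
  rw [homeF, Formula.realize_rel, Home]
  exact iff_of_eq (congrArg _ (funext fun t => by fin_cases t; rfl))

@[simp]
theorem realize_cycF (i j k : α) (v : α → K) :
    (cycF i j k).Realize v ↔ Cyc (v i) (v j) (v k) := by
  rw [cycF, Formula.realize_rel, Cyc]
  exact iff_of_eq (congrArg _ (funext fun t => by fin_cases t <;> rfl))

@[simp]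
theorem realize_pairF (i j k : α) (v : α → K) :
    (pairF i j k).Realize v ↔ Pair (v i) (v j) (v k) := by
  rw [pairF, Formula.realize_rel, Pair]
  exact iff_of_eq (congrArg _ (funext fun t => by fin_cases t <;> rfl))

@[simp]
theorem realize_eqF (i j : α) (v : α → K) : (eqF i j).Realize v ↔ v i = v j := by
  rw [eqF, Formula.realize_equal]; rfl

/-- The tuple `x`, listed in increasing order of the rank `u`, consists of distinct elements of the
home sort and goes around the circle once. -/
structure CyclicallyIncreasing {ι : Type*} (u : ι → ℕ) (x : ι → K) : Prop where
  home : ∀ i, Home (x i)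
  ne : ∀ i j, u i < u j → x i ≠ x j
  cyc : ∀ i j k, u i < u j → u j < u k → Cyc (x i) (x j) (x k)

/-- The formula saying that the subtuple picked out by `f` is cyclically increasing. -/
noncomputable def cyclicallyIncreasingF {ι : Type*} [Finite ι] (u : ι → ℕ) (f : ι → α) :
    L11.Formula α :=
  (Formula.iInf fun i => homeF (f i)) ⊓
    ((Formula.iInf fun t : {t : ι × ι // u t.1 < u t.2} => (eqF (f t.1.1) (f t.1.2)).not) ⊓
      Formula.iInf fun t : {t : ι × ι × ι // u t.1 < u t.2.1 ∧ u t.2.1 < u t.2.2} =>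
        cycF (f t.1.1) (f t.1.2.1) (f t.1.2.2))

@[simp]
theorem realize_cyclicallyIncreasingF {ι : Type*} [Finite ι] (u : ι → ℕ) (f : ι → α)
    (v : α → K) :
    (cyclicallyIncreasingF u f).Realize v ↔ CyclicallyIncreasing u (v ∘ f) := by
  simp only [cyclicallyIncreasingF, Formula.realize_inf, Formula.realize_iInf, realize_homeF,
    Formula.realize_not, realize_eqF, realize_cycF, Subtype.forall, Prod.forall]
  exact ⟨fun h => ⟨h.1, h.2.1, fun i j k h1 h2 => h.2.2 i j k ⟨h1, h2⟩⟩,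
    fun h => ⟨h.home, h.ne, fun i j k h1 => h.cyc i j k h1.1 h1.2⟩⟩

theorem CyclicallyIncreasing.comp {ι ι' : Type*} {u : ι → ℕ} {x : ι → K}
    (h : CyclicallyIncreasing u x) (f : ι' → ι) : CyclicallyIncreasing (u ∘ f) (x ∘ f) :=
  ⟨fun _ => h.home _, fun _ _ => h.ne _ _, fun _ _ _ => h.cyc _ _ _⟩

theorem CyclicallyIncreasing.of_lt_imp {ι : Type*} {u u' : ι → ℕ} {x : ι → K}
    (h : CyclicallyIncreasing u x) (hu : ∀ i j, u' i < u' j → u i < u j) :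
    CyclicallyIncreasing u' x :=
  ⟨h.home, fun _ _ h1 => h.ne _ _ (hu _ _ h1),
    fun _ _ _ h1 h2 => h.cyc _ _ _ (hu _ _ h1) (hu _ _ h2)⟩

/-- The formula saying that all entries of a tuple equal the unordered pair of the endpoints of
some arc. -/
noncomputable def arcPairF (m : ℕ) : L11.Formula (Fin m) :=
  Formula.iExs (Fin 3) (cycF (Sum.inr 0) (Sum.inr 1) (Sum.inr 2) ⊓
    Formula.iInf fun l => pairF (Sum.inr 0) (Sum.inr 2) (Sum.inl l))

theorem realize_arcPairF {m : ℕ} (y : Fin m → K) :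
    (arcPairF m).Realize y ↔ ∃ p x q, Cyc p x q ∧ ∀ l, Pair p q (y l) := by
  simp only [arcPairF, Formula.realize_iExs, Formula.realize_inf, Formula.realize_iInf,
    realize_pairF, realize_cycF, Sum.elim_inl, Sum.elim_inr]
  exact ⟨fun ⟨w, hw⟩ => ⟨w 0, w 1, w 2, hw⟩, fun ⟨p, x, q, h⟩ => ⟨![p, x, q], h⟩⟩

end Relations

section StandardModel

@[simp]
theorem home_iff (a : ℚ ⊕ Sym2 ℚ) : Home a ↔ ∃ x : ℚ, a = Sum.inl x := Iff.rfl

@[simp]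
theorem cyc_iff (a b c : ℚ ⊕ Sym2 ℚ) :
    Cyc a b c ↔ ∃ x y z : ℚ, a = Sum.inl x ∧ b = Sum.inl y ∧ c = Sum.inl z ∧ cycQ x y z :=
  Iff.rfl

@[simp]
theorem pair_iff (a b c : ℚ ⊕ Sym2 ℚ) :
    Pair a b c ↔ ∃ x y : ℚ, a = Sum.inl x ∧ b = Sum.inl y ∧ c = Sum.inr s(x, y) :=
  Iff.rfl

/-- An automorphism of the circular order on `ℚ` induces one of the standard model. -/
def autOfPerm (σ : Equiv.Perm ℚ) (hσ : ∀ x y z, cycQ (σ x) (σ y) (σ z) ↔ cycQ x y z) :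
    (ℚ ⊕ Sym2 ℚ) ≃[L11] (ℚ ⊕ Sym2 ℚ) where
  toEquiv := Equiv.sumCongr σ
    { toFun := Sym2.map σ
      invFun := Sym2.map σ.symm
      left_inv := fun s => by simp [Sym2.map_map]
      right_inv := fun s => by simp [Sym2.map_map] }
  map_fun' := fun f => f.elim
  map_rel' := by
    intro n r v
    have inl_iff : ∀ (a : ℚ ⊕ Sym2 ℚ) (x : ℚ),
        Sum.map σ (Sym2.map σ) a = Sum.inl x ↔ a = Sum.inl (σ.symm x) := by
      rintro (a | a) x <;> simp [Equiv.eq_symm_apply]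
    have inr_iff : ∀ (a : ℚ ⊕ Sym2 ℚ) (s : Sym2 ℚ),
        Sum.map σ (Sym2.map σ) a = Sum.inr s ↔ a = Sum.inr (s.map σ.symm) := by
      rintro (a | a) s
      · simp
      · simp only [Sum.map_inr, Sum.inr.injEq]
        constructor <;> rintro rfl <;> simp [Sym2.map_map]
    cases r with
    | O =>
      change (∃ x, Sum.map σ (Sym2.map σ) (v 0) = Sum.inl x) ↔ ∃ x, v 0 = Sum.inl x
      simp only [inl_iff]
      exact (σ.symm.surjective.exists (p := fun x => v 0 = Sum.inl x)).symm
    | P =>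
      change (∃ x, Sum.map σ (Sym2.map σ) (v 0) = Sum.inr x) ↔ ∃ x, v 0 = Sum.inr x
      rcases v 0 with a | a <;> simp
    | cyc =>
      change (∃ x y z, Sum.map σ (Sym2.map σ) (v 0) = Sum.inl x ∧
          Sum.map σ (Sym2.map σ) (v 1) = Sum.inl y ∧
          Sum.map σ (Sym2.map σ) (v 2) = Sum.inl z ∧ cycQ x y z) ↔
        ∃ x y z, v 0 = Sum.inl x ∧ v 1 = Sum.inl y ∧ v 2 = Sum.inl z ∧ cycQ x y z
      rw [σ.surjective.exists]
      refine exists_congr fun x => ?_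
      rw [σ.surjective.exists]
      refine exists_congr fun y => ?_
      rw [σ.surjective.exists]
      simp [inl_iff, hσ]
    | pair =>
      change (∃ x y, Sum.map σ (Sym2.map σ) (v 0) = Sum.inl x ∧
          Sum.map σ (Sym2.map σ) (v 1) = Sum.inl y ∧
          Sum.map σ (Sym2.map σ) (v 2) = Sum.inr s(x, y)) ↔
        ∃ x y, v 0 = Sum.inl x ∧ v 1 = Sum.inl y ∧ v 2 = Sum.inr s(x, y)
      rw [σ.surjective.exists]
      refine exists_congr fun x => ?_
      rw [σ.surjective.exists]
      simp [inl_iff, inr_iff]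

theorem realize_iff_of_cyclicallyIncreasing_standard {ι : Type*} [Finite ι] {u : ι → ℕ}
    (hu : Function.Injective u) {x y : ι → ℚ ⊕ Sym2 ℚ} (hx : CyclicallyIncreasing u x)
    (hy : CyclicallyIncreasing u y) (φ : L11.Formula ι) : φ.Realize x ↔ φ.Realize y := by
  choose x' hx' using fun i => (home_iff _).1 (hx.home i)
  choose y' hy' using fun i => (home_iff _).1 (hy.home i)
  obtain rfl : x = fun i => Sum.inl (x' i) := funext hx'
  obtain rfl : y = fun i => Sum.inl (y' i) := funext hy'
  have inj : ∀ z : ι → ℚ, CyclicallyIncreasing u (fun i => (Sum.inl (z i) : ℚ ⊕ Sym2 ℚ)) →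
      Function.Injective z := by
    intro z hz i j hij
    by_contra hne
    rcases lt_or_gt_of_ne (hu.ne hne) with h | h
    · exact hz.ne i j h (congrArg _ hij)
    · exact hz.ne j i h (congrArg _ hij.symm)
  have cyc : ∀ z : ι → ℚ, CyclicallyIncreasing u (fun i => (Sum.inl (z i) : ℚ ⊕ Sym2 ℚ)) →
      ∀ i j k, u i < u j → u j < u k → cycQ (z i) (z j) (z k) := by
    intro z hz i j k h1 h2
    simpa using hz.cyc i j k h1 h2
  obtain ⟨σ, hσ, hxy⟩ := exists_cycQ_perm hu (inj _ hx) (inj _ hy) (cyc _ hx) (cyc _ hy)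
  rw [← StrongHomClass.realize_formula (autOfPerm σ hσ)]
  refine iff_of_eq (congrArg _ (funext fun i => ?_))
  exact congrArg Sum.inl (hxy i)

end StandardModel

section Models

variable {K : Type*} [L11.Structure K] [T11.Model K]

theorem realize_of_forall_standard {α : Type*} [Finite α] (φ : L11.Formula α)
    (h : ∀ v : α → ℚ ⊕ Sym2 ℚ, φ.Realize v) (v : α → K) : φ.Realize v := by
  have hs : (Formula.iAlls α (φ.relabel (Sum.inr : α → Empty ⊕ α)) : L11.Sentence) ∈ T11 := by
    rw [T11, mem_completeTheory, Sentence.Realize, Formula.realize_iAlls]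
    intro w
    rw [Formula.realize_relabel]
    exact h w
  have hK := T11.realize_sentence_of_mem (M := K) hs
  rw [Sentence.Realize, Formula.realize_iAlls] at hK
  have := hK v
  rwa [Formula.realize_relabel] at this

/-- Quantifier elimination for cyclically increasing tuples. -/
theorem realize_iff_of_cyclicallyIncreasing {ι : Type*} [Finite ι] {u : ι → ℕ}
    (hu : Function.Injective u) {x y : ι → K} (hx : CyclicallyIncreasing u x)
    (hy : CyclicallyIncreasing u y) (φ : L11.Formula ι) : φ.Realize x ↔ φ.Realize y := by
  have h := realize_of_forall_standard (K := K) (α := ι ⊕ ι)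
    ((cyclicallyIncreasingF u Sum.inl).imp ((cyclicallyIncreasingF u Sum.inr).imp
      ((φ.relabel Sum.inl).iff (φ.relabel Sum.inr))))
    (fun v => by
      simp only [Formula.realize_imp, realize_cyclicallyIncreasingF, Formula.realize_iff,
        Formula.realize_relabel]
      exact fun h1 h2 => realize_iff_of_cyclicallyIncreasing_standard hu h1 h2 φ)
    (Sum.elim x y)
  simp only [Formula.realize_imp, realize_cyclicallyIncreasingF, Formula.realize_iff,
    Formula.realize_relabel, Sum.elim_comp_inl, Sum.elim_comp_inr] at h
  exact h hx hy

theorem Cyc.home {x y z : K} (h : Cyc x y z) : Home x ∧ Home y ∧ Home z := by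
  simpa [h] using realize_of_forall_standard (K := K) (α := Fin 3)
    ((cycF 0 1 2).imp (homeF 0 ⊓ (homeF 1 ⊓ homeF 2))) (fun v => by simp; grind) ![x, y, z]

theorem Cyc.ne {x y z : K} (h : Cyc x y z) : x ≠ y ∧ x ≠ z ∧ y ≠ z := by
  simpa [h] using realize_of_forall_standard (K := K) (α := Fin 3)
    ((cycF 0 1 2).imp ((eqF 0 1).not ⊓ ((eqF 0 2).not ⊓ (eqF 1 2).not)))
    (fun v => by simp [cycQ]; grind) ![x, y, z]

theorem Cyc.trans {p x y z : K} (h : Cyc p x y) (h' : Cyc p y z) : Cyc p x z ∧ Cyc x y z := by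
  simpa [h, h'] using realize_of_forall_standard (K := K) (α := Fin 4)
    ((cycF 0 1 2).imp ((cycF 0 2 3).imp (cycF 0 1 3 ⊓ cycF 1 2 3)))
    (fun v => by simp [cycQ]; grind) ![p, x, y, z]

theorem cyc_or_cyc {x y z : K} (hx : Home x) (hy : Home y) (hz : Home z) (hxy : x ≠ y)
    (hxz : x ≠ z) (hyz : y ≠ z) : Cyc x y z ∨ Cyc z y x := by
  simpa [hx, hy, hz, hxy, hxz, hyz] using realize_of_forall_standard (K := K) (α := Fin 3)
    ((homeF 0).imp ((homeF 1).imp ((homeF 2).imp ((eqF 0 1).not.imp ((eqF 0 2).not.imp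
      ((eqF 1 2).not.imp (cycF 0 1 2 ⊔ cycF 2 1 0)))))))
    (fun v => by simp [cycQ]; grind) ![x, y, z]

theorem not_cyc_of_cyc {p q r s x : K} (h : Cyc p q r) (h' : Cyc p r s) (hx : Cyc p x q) :
    ¬Cyc r x s := by
  simpa [h, h', hx] using realize_of_forall_standard (K := K) (α := Fin 5)
    ((cycF 0 1 2).imp ((cycF 0 2 3).imp ((cycF 0 4 1).imp (cycF 2 4 3).not)))
    (fun v => by simp [cycQ]; grind) ![p, q, r, s, x]

theorem exists_cyc {p q : K} (hp : Home p) (hq : Home q) (hpq : p ≠ q) : ∃ r, Cyc p q r := by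
  have h := realize_of_forall_standard (K := K) (α := Fin 2)
    ((homeF 0).imp ((homeF 1).imp ((eqF 0 1).not.imp
      (Formula.iExs (Fin 1) (cycF (Sum.inl 0) (Sum.inl 1) (Sum.inr 0))))))
    (fun v => by
      simp only [Formula.realize_imp, realize_homeF, Formula.realize_not, realize_eqF,
        Formula.realize_iExs, realize_cycF, Sum.elim_inl, Sum.elim_inr, home_iff]
      rintro ⟨x, hx⟩ ⟨y, hy⟩ hxy
      rw [hx, hy] at hxy ⊢
      obtain ⟨z, hz⟩ := exists_gt (α := Cut x) ⟨y, fun h => hxy (by rw [h])⟩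
      exact ⟨fun _ => Sum.inl z.1, x, y, z.1, rfl, rfl, rfl, (Cut.lt_iff _ _).1 hz⟩) ![p, q]
  simp only [Formula.realize_imp, realize_homeF, Formula.realize_not, realize_eqF,
    Formula.realize_iExs, realize_cycF, Sum.elim_inl, Sum.elim_inr] at h
  obtain ⟨r, hr⟩ := h hp hq hpq
  exact ⟨r 0, hr⟩

theorem Pair.symm {x y b : K} (h : Pair x y b) : Pair y x b := by
  simpa [h] using realize_of_forall_standard (K := K) (α := Fin 3)
    ((pairF 0 1 2).imp (pairF 1 0 2)) (fun v => by simp; grind [Sym2.eq_swap]) ![x, y, b]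

theorem Pair.unique {x y b c : K} (h : Pair x y b) (h' : Pair x y c) : b = c := by
  simpa [h, h'] using realize_of_forall_standard (K := K) (α := Fin 4)
    ((pairF 0 1 2).imp ((pairF 0 1 3).imp (eqF 2 3))) (fun v => by simp; grind) ![x, y, b, c]

theorem Pair.eq_or_eq {x y z w b : K} (h : Pair x y b) (h' : Pair z w b) : z = x ∨ z = y := by
  simpa [h, h'] using realize_of_forall_standard (K := K) (α := Fin 5)
    ((pairF 0 1 4).imp ((pairF 2 3 4).imp (eqF 2 0 ⊔ eqF 2 1)))
    (fun v => by simp; grind [Sym2.eq_iff]) ![x, y, z, w, b]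

end Models

section Dividing

variable {K : Type*} [L11.Structure K] [T11.Model K]

/-- Two distinct points of the home sort begin an infinite cyclically increasing sequence. -/
theorem exists_cyclicallyIncreasing_seq {p q : K} (hp : Home p) (hq : Home q) (hpq : p ≠ q) :
    ∃ e : ℕ → K, e 0 = p ∧ e 1 = q ∧ CyclicallyIncreasing id e := by
  choose! next hnext using fun (r : K) (h : Home r ∧ p ≠ r) => exists_cyc hp h.1 h.2
  let f : ℕ → K := fun n => next^[n] q
  have hf : ∀ n, f (n + 1) = next (f n) := fun n => Function.iterate_succ_apply' next n q
  have good : ∀ n, Home (f n) ∧ p ≠ f n := by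
    intro n
    induction n with
    | zero => exact ⟨hq, hpq⟩
    | succ n ih =>
      rw [hf]
      have := hnext _ ih
      exact ⟨this.home.2.2, this.ne.2.1⟩
  have : IsTrans K (Cyc p) := ⟨fun _ _ _ h h' => (h.trans h').1⟩
  have hlt : ∀ i j, i < j → Cyc p (f i) (f j) := fun i j h =>
    Nat.rel_of_forall_rel_succ_of_lt (Cyc p) (fun n => by rw [hf]; exact hnext _ (good n)) h
  refine ⟨fun n => Nat.casesOn n p f, rfl, rfl, ⟨?_, ?_, ?_⟩⟩
  · rintro (_ | i)
    exacts [hp, (good i).1]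
  · rintro (_ | i) (_ | j) h
    · exact absurd h (lt_irrefl _)
    · exact (good j).2
    · exact absurd h (Nat.not_lt_zero _)
    · exact (hlt i j (Nat.lt_of_succ_lt_succ h)).ne.2.2
  · rintro (_ | i) (_ | j) (_ | k) h h'
    · exact absurd h (lt_irrefl _)
    · exact absurd h (lt_irrefl _)
    · exact absurd h' (Nat.not_lt_zero _)
    · exact hlt j k (Nat.lt_of_succ_lt_succ h')
    · exact absurd h (Nat.not_lt_zero _)
    · exact absurd h (Nat.not_lt_zero _)
    · exact absurd h' (Nat.not_lt_zero _)
    · exact ((hlt i j (Nat.lt_of_succ_lt_succ h)).trans (hlt j k (Nat.lt_of_succ_lt_succ h'))).2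

theorem Cyc.cyclicallyIncreasing {x y z : K} (h : Cyc x y z) :
    CyclicallyIncreasing (fun i : Fin 3 => i.val) ![x, y, z] := by
  refine ⟨?_, ?_, ?_⟩
  · intro i
    fin_cases i
    exacts [h.home.1, h.home.2.1, h.home.2.2]
  · intro i j hij
    fin_cases i <;> fin_cases j <;> simp_all [h.ne]
  · intro i j k hij hjk
    fin_cases i <;> fin_cases j <;> fin_cases k <;> simp_all

/-- Consecutive pairs of a cyclically increasing sequence are indiscernible. -/
theorem CyclicallyIncreasing.indiscernible {e : ℕ → K} (he : CyclicallyIncreasing id e) :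
    Indiscernible L11 K ∅ fun i => ![e (2 * i), e (2 * i + 1)] := by
  intro n s t hs ht k φ c hc
  have key : ∀ r : Fin n → ℕ, StrictMono r →
      CyclicallyIncreasing (fun p : Fin n × Fin 2 => 2 * p.1.val + p.2.val)
        (fun p : Fin n × Fin 2 => ![e (2 * r p.1), e (2 * r p.1 + 1)] p.2) := by
    intro r hr
    have hre : (fun p : Fin n × Fin 2 => ![e (2 * r p.1), e (2 * r p.1 + 1)] p.2) =
        e ∘ fun p => 2 * r p.1 + p.2.val := by
      funext p
      obtain ⟨i, j⟩ := p
      fin_cases j <;> rfl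
    rw [hre]
    refine (he.comp _).of_lt_imp ?_
    rintro ⟨i, i'⟩ ⟨j, j'⟩ h
    simp only [Function.comp_apply, id_eq] at h ⊢
    rcases lt_trichotomy i j with hij | rfl | hij
    · have := hr hij
      omega
    · omega
    · have := Fin.lt_def.1 hij
      omega
  have hu : Function.Injective fun p : Fin n × Fin 2 => 2 * p.1.val + p.2.val := by
    rintro ⟨i, i'⟩ ⟨j, j'⟩ h
    simp only at h
    ext
    · simp only; omega
    · simp only; omega
  have hk : IsEmpty (Fin k) := ⟨fun i => hc i⟩
  have h := realize_iff_of_cyclicallyIncreasing hu (key s hs) (key t ht)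
    (φ.relabel (Sum.elim id hk.elim))
  rw [Formula.realize_relabel, Formula.realize_relabel] at h
  convert h using 2 <;> (ext (i | i); exacts [rfl, hk.elim i])

theorem mem_acl_of_pair {x y b : K} (h : Pair x y b) : x ∈ acl L11 K {b} := by
  have real : ∀ z : K, (Formula.iExs (Fin 1)
      (pairF (Sum.inl 0) (Sum.inr 0) (Sum.inl 1) : L11.Formula (Fin 2 ⊕ Fin 1))).Realize
        (Fin.cons z ![b]) ↔ ∃ w, Pair z w b := by
    intro z
    simp only [Formula.realize_iExs, realize_pairF, Sum.elim_inl, Sum.elim_inr]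
    exact ⟨fun ⟨w, hw⟩ => ⟨w 0, hw⟩, fun ⟨w, hw⟩ => ⟨fun _ => w, hw⟩⟩
  refine ⟨1, _, ![b], by simp, (real x).2 ⟨y, h⟩, Set.Finite.subset (Set.toFinite {x, y}) ?_⟩
  intro z hz
  obtain ⟨w, hw⟩ := (real z).1 hz
  exact h.eq_or_eq hw

/-- An arc of the circle divides over the empty set. -/
theorem formulaDividesOver_arc {ι : Type*} (i : ι) {p q : K} (hp : Home p) (hq : Home q)
    (hpq : p ≠ q) :
    FormulaDividesOver L11 K ∅
      (cycF (Sum.inr 0) (Sum.inl i) (Sum.inr 1) : L11.Formula (ι ⊕ Fin 2)) ![p, q] := by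
  obtain ⟨e, rfl, rfl, he⟩ := exists_cyclicallyIncreasing_seq hp hq hpq
  refine ⟨fun i => ![e (2 * i), e (2 * i + 1)], 2, two_pos, rfl, he.indiscernible, ?_⟩
  rintro s hs ⟨x, hx⟩
  obtain ⟨m, n, hmn, rfl⟩ := Finset.card_eq_two.1 hs
  have arc : ∀ j ∈ ({m, n} : Finset ℕ), Cyc (e (2 * j)) (x i) (e (2 * j + 1)) := by
    intro j hj
    simpa using hx j hj
  have disj : ∀ m n, m < n → Cyc (e (2 * m)) (x i) (e (2 * m + 1)) →
      ¬Cyc (e (2 * n)) (x i) (e (2 * n + 1)) := fun m n h hm =>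
    not_cyc_of_cyc (he.cyc (2 * m) (2 * m + 1) (2 * n) (by simp) (by simp; omega))
      (he.cyc (2 * m) (2 * n) (2 * n + 1) (by simp; omega) (by simp)) hm
  rcases lt_or_gt_of_ne hmn with h | h
  · exact disj m n h (arc m (by simp)) (arc n (by simp))
  · exact disj n m h (arc n (by simp)) (arc m (by simp))

/-- The formula `φ(x, y)`, with `x` a point and `y` a tuple all of whose entries are the unordered
pair of the outer two free variables, in terms of those two variables and `x`. -/
noncomputable def pairInstance {ι : Type*} {m : ℕ} (φ : L11.Formula (ι ⊕ Fin m)) :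
    L11.Formula (Fin 3) :=
  Formula.iExs (Fin m)
    ((Formula.iInf fun l => pairF (Sum.inl 0) (Sum.inl 2) (Sum.inr l)) ⊓
      φ.relabel (Sum.elim (fun _ => Sum.inl 1) Sum.inr))

theorem realize_pairInstance {ι : Type*} {m : ℕ} (φ : L11.Formula (ι ⊕ Fin m)) {p x q : K}
    {y : Fin m → K} (hy : ∀ l, Pair p q (y l)) :
    (pairInstance φ).Realize ![p, x, q] ↔ φ.Realize (Sum.elim (fun _ => x) y) := by
  have hcomp : ∀ w : Fin m → K, Sum.elim ![p, x, q] w ∘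
      (Sum.elim (fun _ => Sum.inl 1) Sum.inr : ι ⊕ Fin m → Fin 3 ⊕ Fin m) =
        Sum.elim (fun _ => x) w := by
    intro w
    ext (i | i) <;> rfl
  simp only [pairInstance, Formula.realize_iExs, Formula.realize_inf, Formula.realize_iInf,
    realize_pairF, Formula.realize_relabel, hcomp, Sum.elim_inl, Sum.elim_inr]
  constructor
  · rintro ⟨w, hw, h⟩
    obtain rfl : w = y := funext fun l => Pair.unique (hw l) (hy l)
    exact h
  · exact fun h => ⟨y, hy, h⟩

/-- A point of an arc is dividing-independent over the empty set from the unordered pair of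
endpoints of the arc. -/
theorem dind_singleton_pair {a p q b : K} (hcyc : Cyc p a q) (hb : Pair p q b) :
    dind L11 K {a} ∅ {b} := by
  rintro ⟨m, φ, y, hy, hφ, bs, k, -, hbs, hind, hk⟩
  have hyb : ∀ l, Pair p q (y l) := fun l => by
    obtain h | h := hy l
    · rwa [Set.mem_singleton_iff.1 h]
    · exact h.elim
  have hbase : (pairInstance φ).Realize ![p, a, q] := by
    rw [realize_pairInstance φ hyb]
    convert hφ using 2
    ext i
    exact i.2.symm
  have hend : ∀ n, ∃ p' x' q', Cyc p' x' q' ∧ ∀ l, Pair p' q' (bs n l) := by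
    intro n
    have h := hind 1 (fun _ => 0) (fun _ => n) (Subsingleton.strictMono _)
      (Subsingleton.strictMono _) 0 ((arcPairF m).relabel fun l => Sum.inl (0, l)) Fin.elim0
      (fun i => i.elim0)
    rw [Formula.realize_relabel, Formula.realize_relabel] at h
    refine (realize_arcPairF _).1 (h.1 ((realize_arcPairF _).2 ⟨p, a, q, hcyc, ?_⟩))
    intro l
    change Pair p q (bs 0 l)
    rw [hbs]
    exact hyb l
  choose p' x' q' hcyc' hpair' using hend
  obtain ⟨e, -, -, he⟩ := exists_cyclicallyIncreasing_seq hcyc.home.1 hcyc.home.2.1 hcyc.ne.1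
  have einj : Function.Injective e := by
    intro i j hij
    by_contra hne
    rcases lt_or_gt_of_ne hne with h | h
    · exact he.ne i j h hij
    · exact he.ne j i h hij.symm
  classical
  obtain ⟨c, hc, hcS⟩ := (Set.infinite_range_of_injective einj).exists_notMem_finset
    ((Finset.range k).image p' ∪ (Finset.range k).image q')
  have hcH : Home c := by
    obtain ⟨i, rfl⟩ := hc
    exact he.home i
  simp only [Finset.mem_union, Finset.mem_image, not_or, not_exists, not_and] at hcS
  refine hk (Finset.range k) (Finset.card_range k) ⟨fun _ => c, fun n hn => ?_⟩
  have hqf : ∀ {r s : K}, Cyc r c s → (∀ l, Pair r s (bs n l)) →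
      φ.Realize (Sum.elim (fun _ => c) (bs n)) := by
    intro r s h hrs
    rw [← realize_pairInstance φ hrs]
    exact (realize_iff_of_cyclicallyIncreasing Fin.val_injective hcyc.cyclicallyIncreasing
      h.cyclicallyIncreasing _).1 hbase
  rcases cyc_or_cyc (hcyc' n).home.1 hcH (hcyc' n).home.2.2 (hcS.1 n hn) (hcyc' n).ne.2.1
    (fun h => hcS.2 n hn h.symm) with h | h
  · exact hqf h (hpair' n)
  · exact hqf h fun l => (hpair' n l).symm

/-- A point of an arc is not dividing-independent over the empty set from the algebraic closure of
the unordered pair of endpoints of the arc. -/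
theorem not_dind_singleton_acl_pair {a p q b : K} (hcyc : Cyc p a q) (hb : Pair p q b) :
    ¬dind L11 K {a} ∅ (acl L11 K {b}) := by
  refine not_not_intro ⟨2, cycF (Sum.inr 0) (Sum.inl ⟨a, rfl⟩) (Sum.inr 1), ![p, q], ?_, ?_,
    formulaDividesOver_arc _ hcyc.home.1 hcyc.home.2.2 hcyc.ne.2.1⟩
  · intro i
    fin_cases i
    exacts [Or.inl (mem_acl_of_pair hb), Or.inl (mem_acl_of_pair hb.symm)]
  · simpa using hcyc

end Dividing

/-- Let `T = Th(ℚ, cyc)^eq`.  In a monster model of `T`, let `a, d₁, d₂` be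
three distinct elements of the home sort with `cyc(d₁, a, d₂)`, and let `b = q(d₁, d₂)`.
Then `a ⫝d_∅ b` but not `a ⫝d_∅ acl(b)`; hence dividing independence fails algebraic
extension over `∅` in `T`. -/
theorem circular_order_dind_fails_algebraic_extension
    (N : Type w) [L11.Structure N] [T11.Model N]
    (κ : Cardinal.{w}) (hN : IsMonster L11 N κ)
    (a d₁ d₂ b : N)
    (hOa : Structure.RelMap (L := L11) Rel11.O ![a])
    (hOd₁ : Structure.RelMap (L := L11) Rel11.O ![d₁])
    (hOd₂ : Structure.RelMap (L := L11) Rel11.O ![d₂])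
    (had₁ : a ≠ d₁) (had₂ : a ≠ d₂) (hd₁d₂ : d₁ ≠ d₂)
    (hcyc : Structure.RelMap (L := L11) Rel11.cyc ![d₁, a, d₂])
    (hb : Structure.RelMap (L := L11) Rel11.pair ![d₁, d₂, b]) :
    dind L11 N {a} ∅ {b} ∧ ¬dind L11 N {a} ∅ (acl L11 N {b}) ∧
      ¬AlgebraicExtensionOver L11 N (dind L11 N) ∅ := by
  have h₁ : dind L11 N {a} ∅ {b} := dind_singleton_pair hcyc hb
  have h₂ : ¬dind L11 N {a} ∅ (acl L11 N {b}) := not_dind_singleton_acl_pair hcyc hb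
  refine ⟨h₁, h₂, fun h => h₂ ?_⟩
  have h₃ := h {a} {b} h₁
  rwa [Set.union_empty] at h₃

end PaperDiv
end

section
/- Let T^eq_f be the imaginary expansion of the model completion T^∅_f of the empty theory in the language with a single binary function symbol f. In a monster model, let M be a small model, let d₁ ≠ d₂ be home-sort elements not in M with f(dᵢ,dⱼ) = dᵢ for all i,j ∈ {1,2} and f(m,dₖ) = f(dₖ,m) = dₖ for all k ∈ {1,2} and m ∈ M, let b = q(d₁,d₂), and let a be a home-sort element with f(a,a) = a, f(a,m) = f(m,a) = a for all m ∈ M, f(a,d₁) = f(d₁,a) = a, and f(a,d₂) = f(d₂,a) = d₁. Then a ⫝d_M b, but a ⫝̸M_M b and a ⫝̸d_M acl(Mb). In particular, in the NSOP₁ theory T^eq_f, dividing independence does not imply M-independence or forking independence, even over a model. -/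
open FirstOrder FirstOrder.Language Set Cardinal

universe u v w x

namespace PaperDiv

variable (L : FirstOrder.Language.{u, v}) (M : Type w) [L.Structure M]

/-! ### The generic binary function with unordered pairs -/

/-- The language of one binary function symbol `f`. -/
inductive Fn12 : ℕ → Type
  | f : Fn12 2

/-- The language `{f}` of `T^∅_f`. -/
abbrev Lf : FirstOrder.Language := ⟨Fn12, fun _ => Empty⟩

/-- `T0` is the model completion of the empty theory in the language `{f}`: every
`{f}`-structure embeds into a model of `T0`; `T0` is model complete (every embedding between
models is elementary); and `T0` together with the diagram of any `{f}`-structure is complete. -/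
def IsModelCompletionOfEmptyTheory (T0 : Lf.Theory) : Prop :=
  (∀ (A : Type w) [Lf.Structure A], ∃ (B : Type w) (inst : Lf.Structure B),
      @FirstOrder.Language.Theory.Model Lf B inst T0 ∧
        Nonempty (@FirstOrder.Language.Embedding Lf A B _ inst)) ∧
  (∀ (B C : Type w) [Lf.Structure B] [Lf.Structure C],
      T0.Model B → T0.Model C → ∀ (g : B ↪[Lf] C) (n : ℕ) (φ : Lf.Formula (Fin n))
        (v : Fin n → B), φ.Realize (g ∘ v) ↔ φ.Realize v) ∧
  (∀ (A B C : Type w) [Lf.Structure A] [Lf.Structure B] [Lf.Structure C],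
      T0.Model B → T0.Model C → ∀ (gB : A ↪[Lf] B) (gC : A ↪[Lf] C) (n : ℕ)
        (φ : Lf.Formula (Fin n)) (v : Fin n → A), φ.Realize (gB ∘ v) ↔ φ.Realize (gC ∘ v))

/-- The relation symbols of the two-sorted language of `T^eq_f` (restricted to the home sort
`O` and the sort `P` of unordered pairs): sort predicates `O` and `P`, the graph `F` of the
binary function `f` on the home sort, and the graph `Q` of the pairing map `q : O² → P`. -/
inductive Rel12 : ℕ → Type
  | O : Rel12 1
  | P : Rel12 1
  | F : Rel12 3
  | Q : Rel12 3

/-- The two-sorted language of (the relevant sorts of) `T^eq_f`. -/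
abbrev L12 : FirstOrder.Language := ⟨fun _ => Empty, Rel12⟩

/-- The standard two-sorted model built from a model `M₀` of `T^∅_f`: the home sort `M₀`
together with the sort `Sym2 M₀` of unordered pairs, where `F` is the graph of `f` and `Q` is
the graph of the pairing map. -/
instance W12Structure (M₀ : Type w) [Lf.Structure M₀] : L12.Structure (M₀ ⊕ Sym2 M₀) where
  funMap := fun e _ => e.elim
  RelMap := fun {n} r v =>
    match r with
    | .O => ∃ x : M₀, v 0 = Sum.inl x
    | .P => ∃ s : Sym2 M₀, v 0 = Sum.inr s
    | .F => ∃ x y : M₀, v 0 = Sum.inl x ∧ v 1 = Sum.inl y ∧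
        v 2 = Sum.inl (Structure.funMap (L := Lf) Fn12.f ![x, y])
    | .Q => ∃ x y : M₀, v 0 = Sum.inl x ∧ v 1 = Sum.inl y ∧ v 2 = Sum.inr s(x, y)

/-- The theory `T^eq_f` (restricted to the two relevant sorts). -/
def T12 (M₀ : Type w) [Lf.Structure M₀] : L12.Theory := L12.completeTheory (M₀ ⊕ Sym2 M₀)

section
variable {S : Type*} [L12.Structure S]

/-- Sort `O` (the home sort). -/
def p12O (x : S) : Prop := Structure.RelMap (L := L12) Rel12.O ![x]
/-- The graph of the binary function `f` on the home sort: `F x y z ↔ f(x,y) = z`. -/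
def p12F (x y z : S) : Prop := Structure.RelMap (L := L12) Rel12.F ![x, y, z]
/-- The graph of the pairing map: `Q x y p ↔ q(x,y) = p`. -/
def p12Q (x y p : S) : Prop := Structure.RelMap (L := L12) Rel12.Q ![x, y, p]

end

section Transfer

variable {K : FirstOrder.Language.{0, 0}}

/-- A form of downward Löwenheim–Skolem for countable languages that includes the case of a
finite structure. -/
theorem exists_countable_elementarySubstructure (hK : K.card ≤ ℵ₀) {A : Type*} [K.Structure A]
    (s : Set A) (hs : s.Countable) :
    ∃ S : K.ElementarySubstructure A, s ⊆ S ∧ Countable S := by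
  rcases finite_or_infinite A with hA | hA
  · exact ⟨⊤, fun x _ => ElementarySubstructure.mem_top x, Subtype.countable⟩
  · obtain ⟨S, hS, hc⟩ := exists_elementarySubstructure_card_eq K s aleph0.{0} le_rfl
      (by simpa using hs.le_aleph0) (by simpa using hK)
      (by simp)
    refine ⟨S, hS, ?_⟩
    rw [← Cardinal.mk_le_aleph0_iff]
    simpa using hc.le

/-- A small structure is isomorphic to one in any prescribed universe. -/
theorem exists_equiv_of_small (A : Type v) [K.Structure A] [Small.{u} A] :
    ∃ (A' : Type u) (_ : K.Structure A'), Nonempty (A ≃[K] A') :=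
  ⟨Shrink.{u} A, (equivShrink A).inducedStructure, ⟨(equivShrink A).inducedStructureEquiv⟩⟩

/-- Realizing a formula only involves finitely many variables. -/
theorem exists_formula_fin {α : Type*} (φ : K.Formula α) :
    ∃ (n : ℕ) (ι : Fin n → α) (ψ : K.Formula (Fin n)),
      ∀ (A : Type w) [K.Structure A] (v : α → A), ψ.Realize (v ∘ ι) ↔ φ.Realize v := by
  classical
  let e := φ.freeVarFinset.equivFin.symm
  refine ⟨_, fun i => (e i : α), φ.restrictFreeVar e.symm, fun A _ v => ?_⟩
  exact BoundedFormula.realize_restrictFreeVar v (fun a => by simp)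

end Transfer

instance countable_Lf_functions : Countable (Σ l, Lf.Functions l) := by
  have : ∀ l, Countable (Lf.Functions l) := fun l =>
    ⟨fun _ => 0, by rintro ⟨⟩ ⟨⟩ _; rfl⟩
  infer_instance

theorem card_Lf_le : Lf.card ≤ ℵ₀ := by
  have h2 : Countable (Σ l, Lf.Relations l) := by
    have : ∀ l, Countable (Lf.Relations l) := fun l => inferInstanceAs (Countable Empty)
    infer_instance
  have : Countable Lf.Symbols := inferInstanceAs (Countable (_ ⊕ _))
  exact Cardinal.mk_le_aleph0

section Completion

variable {T0 : Lf.Theory}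

/-- Quantifier elimination for `T0`, in an arbitrary universe: the formulas satisfied by a tuple
only depend on the isomorphism type of a substructure containing it. -/
theorem realize_iff_of_embeddings (hT0 : IsModelCompletionOfEmptyTheory.{u} T0)
    {A B C : Type w} [Lf.Structure A] [Lf.Structure B] [Lf.Structure C]
    (hB : T0.Model B) (hC : T0.Model C) (gB : A ↪[Lf] B) (gC : A ↪[Lf] C)
    {α : Type*} (φ : Lf.Formula α) (v : α → A) :
    φ.Realize (gB ∘ v) ↔ φ.Realize (gC ∘ v) := by
  obtain ⟨n, ι, ψ, hψ⟩ := exists_formula_fin.{w} φ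
  rw [← hψ, ← hψ]
  let S := Substructure.closure Lf (range (v ∘ ι))
  have hS : Countable S := (countable_range _).substructure_closure Lf
  obtain ⟨SB, hSB, hSBc⟩ := exists_countable_elementarySubstructure card_Lf_le
    (gB '' (S : Set A)) ((to_countable (S : Set A)).image _)
  obtain ⟨SC, hSC, hSCc⟩ := exists_countable_elementarySubstructure card_Lf_le
    (gC '' (S : Set A)) ((to_countable (S : Set A)).image _)
  have key : ∀ (D : Type w) [Lf.Structure D] (_ : T0.Model D) (g : A ↪[Lf] D)
      (SD : Lf.ElementarySubstructure D) (_ : g '' (S : Set A) ⊆ SD) (_ : Countable SD)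
      (S' : Type u) [Lf.Structure S'] (e : S ≃[Lf] S'),
      ∃ (D' : Type u) (_ : Lf.Structure D') (_ : T0.Model D') (h : S' ↪[Lf] D'),
        ∀ x : Fin n → S, ψ.Realize (h ∘ e ∘ x) ↔ ψ.Realize (g ∘ (↑) ∘ x) := by
    intro D _ hD g SD hSD hc S' _ e
    obtain ⟨D', _, ⟨eD⟩⟩ := exists_equiv_of_small.{u} (K := Lf) SD
    have : T0.Model D' := StrongHomClass.theory_model eD
    let i : S ↪[Lf] SD := Embedding.codRestrict (SD : Lf.Substructure D)
      (g.comp S.subtype) (fun c => hSD ⟨c, c.2, rfl⟩)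
    refine ⟨D', _, this, eD.toEmbedding.comp (i.comp e.symm.toEmbedding), fun x => ?_⟩
    have h1 : (eD.toEmbedding.comp (i.comp e.symm.toEmbedding)) ∘ e ∘ x = eD ∘ (i ∘ x) := by
      funext j; simp
    rw [h1, StrongHomClass.realize_formula, ← SD.subtype.map_formula]
    rfl
  obtain ⟨S', _, ⟨e⟩⟩ := exists_equiv_of_small.{u} (K := Lf) S
  obtain ⟨B', _, hB', hb, hbx⟩ := key B hB gB SB hSB hSBc S' e
  obtain ⟨C', _, hC', hc, hcx⟩ := key C hC gC SC hSC hSCc S' e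
  let x : Fin n → S := fun j => ⟨v (ι j), Substructure.subset_closure ⟨j, rfl⟩⟩
  have := hT0.2.2 S' B' C' hB' hC' hb hc n ψ (e ∘ x)
  rw [hbx, hcx] at this
  exact this

/-- Every `{f}`-structure embeds into a model of `T0`, in an arbitrary universe. -/
theorem exists_embedding_model (hT0 : IsModelCompletionOfEmptyTheory.{u} T0)
    (A : Type w) [Lf.Structure A] [Nonempty A] :
    ∃ (B : Type w) (_ : Lf.Structure B), T0.Model B ∧ Nonempty (A ↪[Lf] B) := by
  classical
  obtain ⟨a₀⟩ := ‹Nonempty A›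
  let S : Finset A → Lf.Substructure A := fun F => Substructure.closure Lf (insert a₀ (F : Set A))
  have key : ∀ F : Finset A, ∃ (B : Type) (_ : Lf.Structure B), T0.Model B ∧
      Nonempty (S F ↪[Lf] B) := by
    intro F
    have hc : Countable (S F) :=
      (F.countable_toSet.insert a₀).substructure_closure Lf
    obtain ⟨S', _, ⟨e⟩⟩ := exists_equiv_of_small.{u} (K := Lf) (S F)
    obtain ⟨B, _, hB, ⟨g⟩⟩ := hT0.1 S'
    have hc' : Countable S' := e.toEquiv.symm.countable_iff.2 hc
    obtain ⟨SB, hSB, hSBc⟩ := exists_countable_elementarySubstructure card_Lf_le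
      (range g) (countable_range _)
    obtain ⟨D, _, ⟨eD⟩⟩ := exists_equiv_of_small.{0} (K := Lf) SB
    have : T0.Model SB := inferInstance
    refine ⟨D, _, StrongHomClass.theory_model eD, ⟨eD.toEmbedding.comp
      ((Embedding.codRestrict (SB : Lf.Substructure B) g (fun c => hSB ⟨c, rfl⟩)).comp
        e.toEmbedding)⟩⟩
  choose B iB hB hg using key
  have g := fun F => (hg F).some
  have hne : ∀ F, Nonempty (B F) := fun F =>
    ⟨g F ⟨a₀, Substructure.subset_closure (mem_insert _ _)⟩⟩
  let U : Ultrafilter (Finset A) := Ultrafilter.of Filter.atTop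
  have hU : ∀ s ∈ (Filter.atTop : Filter (Finset A)), s ∈ U := Ultrafilter.of_le _
  have hmem : ∀ a : A, ∀ᶠ F : Finset A in (U : Filter (Finset A)), a ∈ S F := by
    intro a
    refine hU _ (Filter.mem_of_superset (Filter.mem_atTop {a}) fun F hF => ?_)
    refine Substructure.subset_closure (mem_insert_of_mem _ ?_)
    exact hF (Finset.mem_singleton_self a)
  let G : A → ∀ F, B F := fun a F => if h : a ∈ S F then g F ⟨a, h⟩ else (hne F).some
  refine ⟨(U : Filter (Finset A)).Product B, inferInstance, ?_, ⟨?_⟩⟩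
  · refine ⟨fun φ hφ => ?_⟩
    rw [Ultraproduct.sentence_realize]
    exact Filter.Eventually.of_forall fun F => Theory.realize_sentence_of_mem T0 hφ
  · refine ⟨⟨fun a => (G a : (U : Filter (Finset A)).Product B), ?_⟩, ?_, ?_⟩
    · intro a b hab
      have hab' : ∀ᶠ F in (U : Filter (Finset A)), G a F = G b F := Quotient.eq''.1 hab
      obtain ⟨F, h1, h2, h3⟩ := (hab'.and ((hmem a).and (hmem b))).exists
      simp only [G, dif_pos h2, dif_pos h3] at h1
      simpa using (g F).injective h1
    · intro n s x
      change ((G (Structure.funMap s x) : ∀ F, B F) : (U : Filter (Finset A)).Product B)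
        = Structure.funMap s fun i => (G (x i) : (U : Filter (Finset A)).Product B)
      rw [Ultraproduct.funMap_cast]
      refine Quotient.eq''.2 ?_
      have hx : ∀ᶠ F in (U : Filter (Finset A)), ∀ i, x i ∈ S F :=
        Filter.eventually_all.2 fun i => hmem (x i)
      refine Filter.mem_of_superset hx fun F hF => ?_
      have hF' : ∀ i, x i ∈ S F := hF
      have h1 : Structure.funMap s x ∈ S F := (S F).fun_mem s x hF
      have h2 : (⟨Structure.funMap s x, h1⟩ : S F)
        = Structure.funMap s (fun i => (⟨x i, hF i⟩ : S F)) := rfl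
      simp only [mem_ofPred_eq, G, dif_pos h1, h2, (g F).map_fun]
      congr 1
      funext i
      simp [hF' i]
    · intro n r
      exact r.elim

end Completion

section Interpretation

/-- The binary operation of an `{f}`-structure. -/
def fop {X : Type w} [Lf.Structure X] (x y : X) : X := Structure.funMap (L := Lf) Fn12.f ![x, y]

theorem funMap_eq_fop {X : Type w} [Lf.Structure X] (v : Fin 2 → X) :
    Structure.funMap (L := Lf) Fn12.f v = fop (v 0) (v 1) := by
  rw [fop]
  congr 1
  funext i
  fin_cases i <;> rfl

section Rel

variable {X : Type w} [Lf.Structure X]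

theorem relMap_O_iff (v : Fin 1 → X ⊕ Sym2 X) :
    Structure.RelMap (L := L12) Rel12.O v ↔ ∃ x, v 0 = Sum.inl x := Iff.rfl

theorem relMap_P_iff (v : Fin 1 → X ⊕ Sym2 X) :
    Structure.RelMap (L := L12) Rel12.P v ↔ ∃ s, v 0 = Sum.inr s := Iff.rfl

theorem relMap_F_iff (v : Fin 3 → X ⊕ Sym2 X) :
    Structure.RelMap (L := L12) Rel12.F v ↔
      ∃ x y : X, v 0 = Sum.inl x ∧ v 1 = Sum.inl y ∧ v 2 = Sum.inl (fop x y) := Iff.rfl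

theorem relMap_Q_iff (v : Fin 3 → X ⊕ Sym2 X) :
    Structure.RelMap (L := L12) Rel12.Q v ↔
      ∃ x y : X, v 0 = Sum.inl x ∧ v 1 = Sum.inl y ∧ v 2 = Sum.inr s(x, y) := Iff.rfl

end Rel

/-- The tuple of elements of sorts `τ` in the two-sorted structure on `X` that is represented
by a tuple of pairs of elements of `X`. -/
def pairVal {J : Type*} {X : Type w} (τ : J → Bool) (u : J × Bool → X) (j : J) : X ⊕ Sym2 X :=
  if τ j then Sum.inr s(u (j, false), u (j, true)) else Sum.inl (u (j, false))

theorem pairVal_of_true {J : Type*} {X : Type w} {τ : J → Bool} {u : J × Bool → X} {j : J}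
    (h : τ j = true) : pairVal τ u j = Sum.inr s(u (j, false), u (j, true)) := by
  simp [pairVal, h]

theorem pairVal_of_false {J : Type*} {X : Type w} {τ : J → Bool} {u : J × Bool → X} {j : J}
    (h : τ j = false) : pairVal τ u j = Sum.inl (u (j, false)) := by
  simp [pairVal, h]

theorem exists_pairVal_eq {J : Type*} {X : Type w} (v : J → X ⊕ Sym2 X) :
    ∃ (τ : J → Bool) (u : J × Bool → X), pairVal τ u = v := by
  have : ∀ j, ∃ (b : Bool) (u : Bool → X),
      v j = if b then Sum.inr s(u false, u true) else Sum.inl (u false) := by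
    intro j
    rcases v j with x | s
    · exact ⟨false, fun _ => x, rfl⟩
    · induction s with
      | _ x y => exact ⟨true, fun b => if b then y else x, rfl⟩
  choose τ u h using this
  exact ⟨τ, fun p => u p.1 p.2, funext fun j => (h j).symm⟩

theorem pairVal_map {J : Type*} {X Y : Type w} (τ : J → Bool) (u : J × Bool → X) (g : X → Y) :
    pairVal τ (g ∘ u) = Sum.map g (Sym2.map g) ∘ pairVal τ u := by
  funext j
  cases h : τ j
  · simp [pairVal_of_false h]
  · simp [pairVal_of_true h]

/-- The reindexing of representing pairs used for a quantifier over the last variable. -/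
def splitLast (α : Type*) (n : ℕ) :
    (α ⊕ Fin (n + 1)) × Bool → ((α ⊕ Fin n) × Bool) ⊕ Bool
  | (Sum.inl a, c) => Sum.inl (Sum.inl a, c)
  | (Sum.inr i, c) => Fin.lastCases (motive := fun _ => ((α ⊕ Fin n) × Bool) ⊕ Bool)
      (Sum.inr c) (fun i => Sum.inl (Sum.inr i, c)) i

theorem pairVal_splitLast_inr {α : Type*} {n : ℕ} {X : Type w} (τ : α ⊕ Fin n → Bool)
    (b : Bool) (u : (α ⊕ Fin n) × Bool → X) (z : Bool → X) :
    pairVal (Sum.elim (τ ∘ Sum.inl) (Fin.snoc (α := fun _ => Bool) (τ ∘ Sum.inr) b))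
      (Sum.elim u z ∘ splitLast α n) ∘ Sum.inr =
    Fin.snoc (α := fun _ => X ⊕ Sym2 X) (pairVal τ u ∘ Sum.inr)
      (if b then Sum.inr s(z false, z true) else Sum.inl (z false)) := by
  funext i
  refine Fin.lastCases ?_ (fun i => ?_) i <;> simp [pairVal, splitLast]

/-- Formulas about the two-sorted structure on `X` translate to formulas about `X`. -/
theorem exists_translation {α : Type*} {n : ℕ} (φ : L12.BoundedFormula α n)
    (τ : α ⊕ Fin n → Bool) :
    ∃ ψ : Lf.Formula ((α ⊕ Fin n) × Bool), ∀ (X : Type w) [Lf.Structure X]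
      (u : (α ⊕ Fin n) × Bool → X),
      ψ.Realize u ↔ φ.Realize (pairVal τ u ∘ Sum.inl) (pairVal τ u ∘ Sum.inr) := by
  have hterm : ∀ {J : Type _} (t : L12.Term J), ∃ j, t = Term.var j := by
    rintro J (j | ⟨s, _⟩)
    · exact ⟨j, rfl⟩
    · exact s.elim
  have hel : ∀ {n : ℕ} (τ : α ⊕ Fin n → Bool) {X : Type w} (u : (α ⊕ Fin n) × Bool → X),
      Sum.elim (pairVal τ u ∘ Sum.inl) (pairVal τ u ∘ Sum.inr) = pairVal τ u :=
    fun τ _ u => Sum.elim_comp_inl_inr _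
  let V : ∀ {n : ℕ}, (α ⊕ Fin n) → Bool → Lf.Term ((α ⊕ Fin n) × Bool) :=
    fun j c => Term.var (j, c)
  induction φ with
  | falsum => exact ⟨⊥, fun X _ u => Iff.rfl⟩
  | @equal n t₁ t₂ =>
    obtain ⟨i, rfl⟩ := hterm t₁
    obtain ⟨j, rfl⟩ := hterm t₂
    simp only [BoundedFormula.Realize, Term.realize_var, hel]
    rcases hi : τ i <;> rcases hj : τ j
    · refine ⟨(V i false).equal (V j false), fun X _ u => ?_⟩
      simp [pairVal, hi, hj, V]
    · exact ⟨⊥, fun X _ u => by simp [pairVal, hi, hj]⟩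
    · exact ⟨⊥, fun X _ u => by simp [pairVal, hi, hj]⟩
    · refine ⟨((V i false).equal (V j false) ⊓ (V i true).equal (V j true)) ⊔
        ((V i false).equal (V j true) ⊓ (V i true).equal (V j false)), fun X _ u => ?_⟩
      simp [pairVal, hi, hj, V]
  | @rel n l R ts =>
    choose j hj using fun i => hterm (ts i)
    simp only [BoundedFormula.Realize, hj, Term.realize_var, hel]
    cases R with
    | O =>
      rcases h : τ (j 0)
      · exact ⟨⊤, fun X _ u => by simp [relMap_O_iff, pairVal, h]⟩
      · exact ⟨⊥, fun X _ u => by simp [relMap_O_iff, pairVal, h]⟩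
    | P =>
      rcases h : τ (j 0)
      · exact ⟨⊥, fun X _ u => by simp [relMap_P_iff, pairVal, h]⟩
      · exact ⟨⊤, fun X _ u => by simp [relMap_P_iff, pairVal, h]⟩
    | F =>
      rcases h0 : τ (j 0) <;> rcases h1 : τ (j 1) <;> rcases h2 : τ (j 2)
      · refine ⟨(V (j 2) false).equal (Functions.apply₂ (L := Lf) Fn12.f
          (V (j 0) false) (V (j 1) false)), fun X _ u => ?_⟩
        simp [relMap_F_iff, pairVal, h0, h1, h2, V, funMap_eq_fop]
      all_goals exact ⟨⊥, fun X _ u => by simp [relMap_F_iff, pairVal, h0, h1, h2]⟩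
    | Q =>
      rcases h0 : τ (j 0) <;> rcases h1 : τ (j 1) <;> rcases h2 : τ (j 2)
      · exact ⟨⊥, fun X _ u => by simp [relMap_Q_iff, pairVal, h0, h1, h2]⟩
      · refine ⟨((V (j 2) false).equal (V (j 0) false) ⊓ (V (j 2) true).equal (V (j 1) false)) ⊔
          ((V (j 2) false).equal (V (j 1) false) ⊓ (V (j 2) true).equal (V (j 0) false)),
          fun X _ u => ?_⟩
        simp [relMap_Q_iff, pairVal, h0, h1, h2, V]
      all_goals exact ⟨⊥, fun X _ u => by simp [relMap_Q_iff, pairVal, h0, h1, h2]⟩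
  | imp φ₁ φ₂ ih₁ ih₂ =>
    obtain ⟨ψ₁, h₁⟩ := ih₁ τ
    obtain ⟨ψ₂, h₂⟩ := ih₂ τ
    exact ⟨ψ₁.imp ψ₂, fun X _ u => by
      rw [Formula.realize_imp, h₁, h₂, BoundedFormula.realize_imp]⟩
  | @all n φ ih =>
    choose ψ hψ using fun b => ih (Sum.elim (τ ∘ Sum.inl) (Fin.snoc (α := fun _ => Bool)
      (τ ∘ Sum.inr) b))
    refine ⟨((ψ false).relabel (splitLast α n)).iAlls Bool ⊓
      ((ψ true).relabel (splitLast α n)).iAlls Bool, fun X _ u => ?_⟩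
    have hz : ∀ b (z : Bool → X), (ψ b).Realize (Sum.elim u z ∘ splitLast α n) ↔
        φ.Realize (pairVal τ u ∘ Sum.inl) (Fin.snoc (α := fun _ => X ⊕ Sym2 X)
          (pairVal τ u ∘ Sum.inr)
          (if b then Sum.inr s(z false, z true) else Sum.inl (z false))) := by
      intro b z
      rw [hψ, pairVal_splitLast_inr]
      rfl
    rw [Formula.realize_inf, Formula.realize_iAlls, Formula.realize_iAlls,
      BoundedFormula.realize_all]
    constructor
    · rintro ⟨h0, h1⟩ (x | s)
      · exact (hz false fun _ => x).1 (Formula.realize_relabel.1 (h0 fun _ => x))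
      · induction s with
        | _ x y =>
          let z : Bool → X := fun b => if b then y else x
          exact (hz true z).1 (Formula.realize_relabel.1 (h1 z))
    · intro h
      exact ⟨fun z => Formula.realize_relabel.2 ((hz false z).2 (h _)),
        fun z => Formula.realize_relabel.2 ((hz true z).2 (h _))⟩

/-- The tuples of the two-sorted structures on two models have the same type when they come from
a common substructure. -/
theorem realize_map_iff_of_embeddings {T0 : Lf.Theory}
    (hT0 : IsModelCompletionOfEmptyTheory.{u} T0)
    {A B C : Type w} [Lf.Structure A] [Lf.Structure B] [Lf.Structure C]
    (hB : T0.Model B) (hC : T0.Model C) (gB : A ↪[Lf] B) (gC : A ↪[Lf] C)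
    {α : Type*} (φ : L12.Formula α) (v : α → A ⊕ Sym2 A) :
    φ.Realize (Sum.map gB (Sym2.map gB) ∘ v) ↔ φ.Realize (Sum.map gC (Sym2.map gC) ∘ v) := by
  obtain ⟨τ, t, rfl⟩ := exists_pairVal_eq v
  let τ' : α ⊕ Fin 0 → Bool := Sum.elim τ Fin.elim0
  let t' : (α ⊕ Fin 0) × Bool → A := fun p => Sum.elim (fun a => t (a, p.2)) Fin.elim0 p.1
  obtain ⟨ψ, hψ⟩ := exists_translation.{w} φ τ'
  have h1 := hψ B (gB ∘ t')
  have h2 := hψ C (gC ∘ t')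
  have e1 : ∀ {D : Type w} (g : A → D), pairVal τ' (g ∘ t') ∘ Sum.inl =
      Sum.map g (Sym2.map g) ∘ pairVal τ t := by
    intro D g
    rw [← pairVal_map]
    rfl
  rw [e1, Formula.boundedFormula_realize_eq_realize] at h1 h2
  rw [← h1, ← h2]
  exact realize_iff_of_embeddings hT0 hB hC gB gC ψ t'

/-- Graphs of `{f}`-terms are definable in the two-sorted structures. -/
theorem exists_term_graph {α : Type*} (t : Lf.Term α) :
    ∃ θ : L12.Formula (α ⊕ Unit), ∀ (X : Type w) [Lf.Structure X] (v : α → X) (y : X ⊕ Sym2 X),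
      θ.Realize (Sum.elim (Sum.inl ∘ v) fun _ => y) ↔ y = Sum.inl (t.realize v) := by
  induction t with
  | var a =>
    refine ⟨Term.equal (Term.var (Sum.inr ())) (Term.var (Sum.inl a)), fun X _ v y => ?_⟩
    simp
  | @func n s ts ih =>
    cases s with
    | f =>
      choose θ hθ using ih
      let ρ : Fin 2 → α ⊕ Unit → (α ⊕ Unit) ⊕ Fin 2 := fun i =>
        Sum.elim (Sum.inl ∘ Sum.inl) fun _ => Sum.inr i
      let χ : L12.Formula ((α ⊕ Unit) ⊕ Fin 2) := (θ 0).relabel (ρ 0) ⊓ (θ 1).relabel (ρ 1) ⊓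
        Relations.formula (L := L12) Rel12.F
          ![Term.var (Sum.inr 0), Term.var (Sum.inr 1), Term.var (Sum.inl (Sum.inr ()))]
      refine ⟨χ.iExs (Fin 2), fun X _ v y => ?_⟩
      have hρ : ∀ (i : Fin 2) (z : Fin 2 → X ⊕ Sym2 X),
          (fun a => Sum.elim (Sum.elim (Sum.inl ∘ v) fun _ => y) z a) ∘ ρ i =
            Sum.elim (Sum.inl ∘ v) fun _ => z i := by
        intro i z
        funext a
        rcases a with a | a <;> rfl
      rw [Formula.realize_iExs]
      simp only [χ, Formula.realize_inf, Formula.realize_relabel, hρ, hθ, Formula.realize_rel,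
        relMap_F_iff, Term.realize_func, funMap_eq_fop]
      constructor
      · rintro ⟨z, ⟨h0, h1⟩, x, x', hx, hx', hy⟩
        simp only [Matrix.cons_val_zero, Matrix.cons_val_one, Matrix.cons_val, Term.realize_var,
          Sum.elim_inl, Sum.elim_inr] at hx hx' hy
        rw [hx] at h0
        rw [hx'] at h1
        rw [hy, Sum.inl.inj h0, Sum.inl.inj h1]
      · intro h
        exact ⟨fun i => Sum.inl ((ts i).realize v), ⟨rfl, rfl⟩, _, _, rfl, rfl, h⟩

/-- Formulas about `X` translate to formulas about the two-sorted structure on `X`. -/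
theorem exists_relativization {α : Type*} {n : ℕ} (φ : Lf.BoundedFormula α n) :
    ∃ ψ : L12.Formula (α ⊕ Fin n), ∀ (X : Type w) [Lf.Structure X] (v : α ⊕ Fin n → X),
      ψ.Realize (Sum.inl ∘ v : _ → X ⊕ Sym2 X) ↔ φ.Realize (v ∘ Sum.inl) (v ∘ Sum.inr) := by
  induction φ with
  | falsum => exact ⟨⊥, fun X _ v => Iff.rfl⟩
  | @equal n t₁ t₂ =>
    obtain ⟨θ₁, h₁⟩ := exists_term_graph.{w} t₁
    obtain ⟨θ₂, h₂⟩ := exists_term_graph.{w} t₂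
    refine ⟨(θ₁ ⊓ θ₂).iExs Unit, fun X _ v => ?_⟩
    rw [Formula.realize_iExs]
    have hz : ∀ z : Unit → X ⊕ Sym2 X, (fun a => Sum.elim (Sum.inl ∘ v) z a) =
        Sum.elim (Sum.inl ∘ v) fun _ => z () := fun z => rfl
    simp only [Formula.realize_inf, hz, h₁, h₂, BoundedFormula.Realize, Sum.elim_comp_inl_inr]
    constructor
    · rintro ⟨z, h, h'⟩
      exact Sum.inl.inj (h.symm.trans h')
    · intro h
      exact ⟨fun _ => Sum.inl (t₁.realize v), rfl, by rw [h]⟩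
  | rel R ts => exact R.elim
  | imp φ₁ φ₂ ih₁ ih₂ =>
    obtain ⟨ψ₁, h₁⟩ := ih₁
    obtain ⟨ψ₂, h₂⟩ := ih₂
    exact ⟨ψ₁.imp ψ₂, fun X _ v => by
      rw [Formula.realize_imp, h₁, h₂, BoundedFormula.realize_imp]⟩
  | @all n φ ih =>
    obtain ⟨ψ, hψ⟩ := ih
    let ρ : α ⊕ Fin (n + 1) → (α ⊕ Fin n) ⊕ Unit := Sum.elim (Sum.inl ∘ Sum.inl)
      (Fin.lastCases (motive := fun _ => (α ⊕ Fin n) ⊕ Unit) (Sum.inr ())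
        (fun i => Sum.inl (Sum.inr i)))
    refine ⟨((Relations.formula (L := L12) Rel12.O ![Term.var (Sum.inr ())]).imp
      (ψ.relabel ρ)).iAlls Unit, fun X _ v => ?_⟩
    have hx : ∀ x : X, ψ.Realize ((fun a => Sum.elim (Sum.inl ∘ v)
        (fun _ : Unit => (Sum.inl x : X ⊕ Sym2 X)) a) ∘ ρ) ↔
        φ.Realize (v ∘ Sum.inl) (Fin.snoc (α := fun _ => X) (v ∘ Sum.inr) x) := by
      intro x
      have e : (fun a => Sum.elim (Sum.inl ∘ v) (fun _ : Unit => (Sum.inl x : X ⊕ Sym2 X)) a) ∘ ρ =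
          Sum.inl ∘ Sum.elim (v ∘ Sum.inl) (Fin.snoc (α := fun _ => X) (v ∘ Sum.inr) x) := by
        funext a
        rcases a with a | i
        · rfl
        · refine Fin.lastCases ?_ (fun i => ?_) i <;> simp [ρ]
      rw [e, hψ]
      rfl
    rw [Formula.realize_iAlls, BoundedFormula.realize_all]
    simp only [Formula.realize_imp, Formula.realize_relabel, Formula.realize_rel, relMap_O_iff]
    constructor
    · intro h x
      exact (hx x).1 (h (fun _ => Sum.inl x) ⟨x, rfl⟩)
    · rintro h z ⟨x, hz⟩
      have : z = fun _ => Sum.inl x := funext fun _ => hz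
      subst this
      exact (hx x).2 (h x)

end Interpretation

section Decomposition

/-- The sort of unordered pairs. -/
def p12P {S : Type*} [L12.Structure S] (x : S) : Prop := Structure.RelMap (L := L12) Rel12.P ![x]

/-- The atomic formula `O(xᵢ)`. -/
def fmO {J : Type*} (i : J) : L12.Formula J :=
  Relations.formula (L := L12) Rel12.O ![Term.var i]

/-- The atomic formula `P(xᵢ)`. -/
def fmP {J : Type*} (i : J) : L12.Formula J :=
  Relations.formula (L := L12) Rel12.P ![Term.var i]

/-- The atomic formula `f(xᵢ, xⱼ) = xₖ`. -/
def fmF {J : Type*} (i j k : J) : L12.Formula J :=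
  Relations.formula (L := L12) Rel12.F ![Term.var i, Term.var j, Term.var k]

/-- The atomic formula `q(xᵢ, xⱼ) = xₖ`. -/
def fmQ {J : Type*} (i j k : J) : L12.Formula J :=
  Relations.formula (L := L12) Rel12.Q ![Term.var i, Term.var j, Term.var k]

/-- The atomic formula `xᵢ = xⱼ`. -/
def fmE {J : Type*} (i j : J) : L12.Formula J := Term.equal (Term.var i) (Term.var j)

section Realize

variable {S : Type*} [L12.Structure S] {J : Type*} (v : J → S) (i j k : J)

theorem realize_fmO : (fmO i).Realize v ↔ p12O (v i) := by
  rw [fmO, Formula.realize_rel, p12O]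
  refine iff_of_eq (congrArg _ (funext fun l => ?_))
  fin_cases l; rfl

theorem realize_fmP : (fmP i).Realize v ↔ p12P (v i) := by
  rw [fmP, Formula.realize_rel, p12P]
  refine iff_of_eq (congrArg _ (funext fun l => ?_))
  fin_cases l; rfl

theorem realize_fmF : (fmF i j k).Realize v ↔ p12F (v i) (v j) (v k) := by
  rw [fmF, Formula.realize_rel, p12F]
  refine iff_of_eq (congrArg _ (funext fun l => ?_))
  fin_cases l <;> rfl

theorem realize_fmQ : (fmQ i j k).Realize v ↔ p12Q (v i) (v j) (v k) := by
  rw [fmQ, Formula.realize_rel, p12Q]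
  refine iff_of_eq (congrArg _ (funext fun l => ?_))
  fin_cases l <;> rfl

theorem realize_fmE : (fmE i j).Realize v ↔ v i = v j := by
  simp [fmE]

end Realize

section Standard

variable {X : Type w} [Lf.Structure X]

theorem p12O_iff (a : X ⊕ Sym2 X) : p12O a ↔ ∃ x, a = Sum.inl x := Iff.rfl

theorem p12F_iff (a b c : X ⊕ Sym2 X) :
    p12F a b c ↔ ∃ x y : X, a = Sum.inl x ∧ b = Sum.inl y ∧ c = Sum.inl (fop x y) := Iff.rfl

theorem p12Q_iff (a b c : X ⊕ Sym2 X) :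
    p12Q a b c ↔ ∃ x y : X, a = Sum.inl x ∧ b = Sum.inl y ∧ c = Sum.inr s(x, y) := Iff.rfl

end Standard

section Transport

variable {S S' : Type*} [L12.Structure S] [L12.Structure S'] (e : S ≃[L12] S')

theorem p12O_map (a : S) : p12O (e a) ↔ p12O a := by
  have h := StrongHomClass.realize_formula e (fmO (0 : Fin 1)) (v := ![a])
  rwa [realize_fmO, realize_fmO] at h

theorem p12F_map (a b c : S) : p12F (e a) (e b) (e c) ↔ p12F a b c := by
  have h := StrongHomClass.realize_formula e (fmF (0 : Fin 3) 1 2) (v := ![a, b, c])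
  rwa [realize_fmF, realize_fmF] at h

theorem p12Q_map (a b c : S) : p12Q (e a) (e b) (e c) ↔ p12Q a b c := by
  have h := StrongHomClass.realize_formula e (fmQ (0 : Fin 3) 1 2) (v := ![a, b, c])
  rwa [realize_fmQ, realize_fmQ] at h

end Transport

theorem realize_iAlls_relabel_iff {S : Type*} [L12.Structure S] {k : ℕ}
    (χ : L12.Formula (Fin k)) :
    S ⊨ (χ.relabel (Sum.inr : Fin k → Empty ⊕ Fin k)).iAlls (Fin k) ↔
      ∀ v : Fin k → S, χ.Realize v := by
  simp only [Sentence.Realize, Formula.realize_iAlls, Formula.realize_relabel]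
  rfl

theorem forall_realize_of_equivalent {S S' : Type*} [L12.Structure S] [L12.Structure S']
    (h : S ≅[L12] S') {k : ℕ} (χ : L12.Formula (Fin k)) (hχ : ∀ v : Fin k → S, χ.Realize v)
    (v : Fin k → S') : χ.Realize v :=
  (realize_iAlls_relabel_iff χ).1
    ((h.realize_sentence _).1 ((realize_iAlls_relabel_iff χ).2 hχ)) v

/-- The basic properties of the two-sorted structures. -/
structure IsPairing (S : Type*) [L12.Structure S] : Prop where
  O_or_P : ∀ a : S, p12O a ∨ p12P a
  not_O_P : ∀ a : S, ¬(p12O a ∧ p12P a)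
  F_sort : ∀ a b c : S, p12F a b c → p12O a ∧ p12O b ∧ p12O c
  F_ex : ∀ a b : S, p12O a → p12O b → ∃ c, p12F a b c
  F_unique : ∀ a b c c' : S, p12F a b c → p12F a b c' → c = c'
  Q_sort : ∀ a b c : S, p12Q a b c → p12O a ∧ p12O b ∧ p12P c
  Q_ex : ∀ a b : S, p12O a → p12O b → ∃ c, p12Q a b c
  Q_unique : ∀ a b c c' : S, p12Q a b c → p12Q a b c' → c = c'
  Q_surj : ∀ c : S, p12P c → ∃ a b, p12Q a b c
  Q_inj : ∀ a b a' b' c : S, p12Q a b c → p12Q a' b' c →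
    (a = a' ∧ b = b') ∨ (a = b' ∧ b = a')
  Q_symm : ∀ a b c : S, p12Q a b c → p12Q b a c

theorem isPairing_standard (X : Type w) [Lf.Structure X] : IsPairing (X ⊕ Sym2 X) where
  O_or_P := by
    rintro (x | s)
    · exact Or.inl ⟨x, rfl⟩
    · exact Or.inr ⟨s, rfl⟩
  not_O_P := by
    rintro _ ⟨⟨x, rfl⟩, ⟨s, h⟩⟩
    cases h
  F_sort := by
    rintro _ _ _ ⟨x, y, rfl, rfl, rfl⟩
    exact ⟨⟨_, rfl⟩, ⟨_, rfl⟩, ⟨_, rfl⟩⟩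
  F_ex := by
    rintro _ _ ⟨x, rfl⟩ ⟨y, rfl⟩
    exact ⟨_, x, y, rfl, rfl, rfl⟩
  F_unique := by
    rintro _ _ _ _ ⟨x, y, rfl, rfl, rfl⟩ ⟨x', y', h1, h2, rfl⟩
    rw [Sum.inl.inj h1, Sum.inl.inj h2]
  Q_sort := by
    rintro _ _ _ ⟨x, y, rfl, rfl, rfl⟩
    exact ⟨⟨_, rfl⟩, ⟨_, rfl⟩, ⟨_, rfl⟩⟩
  Q_ex := by
    rintro _ _ ⟨x, rfl⟩ ⟨y, rfl⟩
    exact ⟨_, x, y, rfl, rfl, rfl⟩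
  Q_unique := by
    rintro _ _ _ _ ⟨x, y, rfl, rfl, rfl⟩ ⟨x', y', h1, h2, rfl⟩
    rw [Sum.inl.inj h1, Sum.inl.inj h2]
  Q_surj := by
    rintro _ ⟨s, rfl⟩
    induction s with
    | _ x y => exact ⟨_, _, x, y, rfl, rfl, rfl⟩
  Q_inj := by
    rintro _ _ _ _ _ ⟨x, y, rfl, rfl, rfl⟩ ⟨x', y', rfl, rfl, h⟩
    simpa using h
  Q_symm := by
    rintro _ _ _ ⟨x, y, rfl, rfl, rfl⟩
    exact ⟨y, x, rfl, rfl, by rw [Sym2.eq_swap]; rfl⟩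

theorem IsPairing.of_equivalent {S S' : Type*} [L12.Structure S] [L12.Structure S']
    (h : S ≅[L12] S') (hS : IsPairing S) : IsPairing S' where
  O_or_P a := by
    simpa [realize_fmO, realize_fmP] using forall_realize_of_equivalent h
      (fmO (0 : Fin 1) ⊔ fmP 0) (fun v => by
        simpa [realize_fmO, realize_fmP] using hS.O_or_P (v 0)) ![a]
  not_O_P a := by
    simpa [realize_fmO, realize_fmP] using forall_realize_of_equivalent h
      (fmO (0 : Fin 1) ⊓ fmP 0).not (fun v => by
        simpa [realize_fmO, realize_fmP] using hS.not_O_P (v 0)) ![a]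
  F_sort a b c := by
    simpa [realize_fmO, realize_fmF] using forall_realize_of_equivalent h
      ((fmF (0 : Fin 3) 1 2).imp (fmO 0 ⊓ (fmO 1 ⊓ fmO 2))) (fun v => by
        simpa [realize_fmO, realize_fmF] using hS.F_sort (v 0) (v 1) (v 2)) ![a, b, c]
  F_ex a b ha hb := by
    have := forall_realize_of_equivalent h
      ((fmO (0 : Fin 2) ⊓ fmO 1).imp
        ((fmF (Sum.inl 0) (Sum.inl 1) (Sum.inr ()) : L12.Formula (Fin 2 ⊕ Unit)).iExs Unit))
      (fun v => by
        simp only [Formula.realize_imp, Formula.realize_inf, Formula.realize_iExs, realize_fmO,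
          realize_fmF]
        rintro ⟨h0, h1⟩
        obtain ⟨c, hc⟩ := hS.F_ex _ _ h0 h1
        exact ⟨fun _ => c, hc⟩) ![a, b]
    simp only [Formula.realize_imp, Formula.realize_inf, Formula.realize_iExs, realize_fmO,
      realize_fmF] at this
    obtain ⟨c, hc⟩ := this ⟨ha, hb⟩
    exact ⟨c (), hc⟩
  F_unique a b c c' := by
    simpa [realize_fmE, realize_fmF] using forall_realize_of_equivalent h
      ((fmF (0 : Fin 4) 1 2).imp ((fmF 0 1 3).imp (fmE 2 3))) (fun v => by
        simpa [realize_fmE, realize_fmF] using hS.F_unique (v 0) (v 1) (v 2) (v 3))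
        ![a, b, c, c']
  Q_sort a b c := by
    simpa [realize_fmO, realize_fmP, realize_fmQ] using forall_realize_of_equivalent h
      ((fmQ (0 : Fin 3) 1 2).imp (fmO 0 ⊓ (fmO 1 ⊓ fmP 2))) (fun v => by
        simpa [realize_fmO, realize_fmP, realize_fmQ] using hS.Q_sort (v 0) (v 1) (v 2))
        ![a, b, c]
  Q_ex a b ha hb := by
    have := forall_realize_of_equivalent h
      ((fmO (0 : Fin 2) ⊓ fmO 1).imp
        ((fmQ (Sum.inl 0) (Sum.inl 1) (Sum.inr ()) : L12.Formula (Fin 2 ⊕ Unit)).iExs Unit))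
      (fun v => by
        simp only [Formula.realize_imp, Formula.realize_inf, Formula.realize_iExs, realize_fmO,
          realize_fmQ]
        rintro ⟨h0, h1⟩
        obtain ⟨c, hc⟩ := hS.Q_ex _ _ h0 h1
        exact ⟨fun _ => c, hc⟩) ![a, b]
    simp only [Formula.realize_imp, Formula.realize_inf, Formula.realize_iExs, realize_fmO,
      realize_fmQ] at this
    obtain ⟨c, hc⟩ := this ⟨ha, hb⟩
    exact ⟨c (), hc⟩
  Q_unique a b c c' := by
    simpa [realize_fmE, realize_fmQ] using forall_realize_of_equivalent h
      ((fmQ (0 : Fin 4) 1 2).imp ((fmQ 0 1 3).imp (fmE 2 3))) (fun v => by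
        simpa [realize_fmE, realize_fmQ] using hS.Q_unique (v 0) (v 1) (v 2) (v 3))
        ![a, b, c, c']
  Q_surj c hc := by
    have := forall_realize_of_equivalent h
      ((fmP (0 : Fin 1)).imp
        ((fmQ (Sum.inr 0) (Sum.inr 1) (Sum.inl 0) : L12.Formula (Fin 1 ⊕ Fin 2)).iExs (Fin 2)))
      (fun v => by
        simp only [Formula.realize_imp, Formula.realize_iExs, realize_fmP, realize_fmQ]
        intro h0
        obtain ⟨a, b, hc⟩ := hS.Q_surj _ h0
        exact ⟨![a, b], hc⟩) ![c]
    simp only [Formula.realize_imp, Formula.realize_iExs, realize_fmP, realize_fmQ] at this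
    obtain ⟨z, hz⟩ := this hc
    exact ⟨z 0, z 1, hz⟩
  Q_inj a b a' b' c := by
    simpa [realize_fmE, realize_fmQ] using forall_realize_of_equivalent h
      ((fmQ (0 : Fin 5) 1 4).imp ((fmQ 2 3 4).imp
        ((fmE 0 2 ⊓ fmE 1 3) ⊔ (fmE 0 3 ⊓ fmE 1 2)))) (fun v => by
        simpa [realize_fmE, realize_fmQ] using hS.Q_inj (v 0) (v 1) (v 2) (v 3) (v 4))
        ![a, b, a', b', c]
  Q_symm a b c := by
    simpa [realize_fmQ] using forall_realize_of_equivalent h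
      ((fmQ (0 : Fin 3) 1 2).imp (fmQ 1 0 2)) (fun v => by
        simpa [realize_fmQ] using hS.Q_symm (v 0) (v 1) (v 2)) ![a, b, c]

/-- A structure with the basic properties is isomorphic to the standard one built from its
home sort. -/
theorem IsPairing.exists_equiv {S : Type w} [L12.Structure S] (hS : IsPairing S) :
    ∃ (X : Type w) (_ : Lf.Structure X), Nonempty ((X ⊕ Sym2 X) ≃[L12] S) := by
  let X : Type w := {x : S // p12O x}
  choose g hg using fun x y : X => hS.F_ex x.1 y.1 x.2 y.2
  choose q hq using fun x y : X => hS.Q_ex x.1 y.1 x.2 y.2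
  have hgO : ∀ x y, p12O (g x y) := fun x y => (hS.F_sort _ _ _ (hg x y)).2.2
  have hqP : ∀ x y, p12P (q x y) := fun x y => (hS.Q_sort _ _ _ (hq x y)).2.2
  let inst : Lf.Structure X :=
    { funMap := fun {n} s => match n, s with
        | _, Fn12.f => fun v => ⟨g (v 0) (v 1), hgO _ _⟩
      RelMap := fun r _ => r.elim }
  have hfop : ∀ x y : X, (fop x y).1 = g x y := fun x y => rfl
  let Q : Sym2 X → S := Sym2.lift ⟨q, fun x y =>
    hS.Q_unique _ _ _ _ (hq x y) (hS.Q_symm _ _ _ (hq y x))⟩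
  have hQ : ∀ x y : X, p12Q x.1 y.1 (Q s(x, y)) := hq
  have hQP : ∀ s : Sym2 X, p12P (Q s) := by
    intro s
    induction s with
    | _ x y => exact hqP x y
  let E : X ⊕ Sym2 X → S := Sum.elim Subtype.val Q
  have hE : Function.Bijective E := by
    constructor
    · rintro (x | s) (y | t) hxy
      · exact congrArg _ (Subtype.ext hxy)
      · exact (hS.not_O_P (x : S) ⟨x.2, by
          rw [show (x : S) = Q t from hxy]; exact hQP t⟩).elim
      · exact (hS.not_O_P (y : S) ⟨y.2, by
          rw [show (y : S) = Q s from hxy.symm]; exact hQP s⟩).elim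
      · induction s with
        | _ x y =>
          induction t with
          | _ x' y' =>
            have h : Q s(x, y) = Q s(x', y') := hxy
            have := hS.Q_inj _ _ _ _ _ (hQ x y) (by rw [h]; exact hQ x' y')
            rcases this with ⟨h1, h2⟩ | ⟨h1, h2⟩
            · rw [Subtype.ext h1, Subtype.ext h2]
            · rw [Subtype.ext h1, Subtype.ext h2, Sym2.eq_swap]
    · intro c
      rcases hS.O_or_P c with hc | hc
      · exact ⟨Sum.inl ⟨c, hc⟩, rfl⟩
      · obtain ⟨a, b, h⟩ := hS.Q_surj c hc
        obtain ⟨ha, hb, -⟩ := hS.Q_sort _ _ _ h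
        exact ⟨Sum.inr s(⟨a, ha⟩, ⟨b, hb⟩), hS.Q_unique _ _ _ _ (hQ ⟨a, ha⟩ ⟨b, hb⟩) h⟩
  refine ⟨X, inst, ⟨⟨Equiv.ofBijective E hE, fun s => s.elim, fun {n} r v => ?_⟩⟩⟩
  change Structure.RelMap r (E ∘ v) ↔ _
  have h1 : ∀ (v : Fin 1 → S), v = ![v 0] := fun v => by
    funext i; fin_cases i; rfl
  have h3 : ∀ (v : Fin 3 → S), v = ![v 0, v 1, v 2] := fun v => by
    funext i; fin_cases i <;> rfl
  cases r with
  | O =>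
    rw [h1 (E ∘ v), relMap_O_iff]
    change p12O (E (v 0)) ↔ _
    rcases v 0 with x | s
    · exact iff_of_true x.2 ⟨x, rfl⟩
    · refine iff_of_false (fun h => hS.not_O_P _ ⟨h, hQP s⟩) ?_
      rintro ⟨x, h⟩
      cases h
  | P =>
    rw [h1 (E ∘ v), relMap_P_iff]
    change p12P (E (v 0)) ↔ _
    rcases v 0 with x | s
    · refine iff_of_false (fun h => hS.not_O_P _ ⟨x.2, h⟩) ?_
      rintro ⟨x, h⟩
      cases h
    · exact iff_of_true (hQP s) ⟨s, rfl⟩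
  | F =>
    rw [h3 (E ∘ v), relMap_F_iff]
    change p12F (E (v 0)) (E (v 1)) (E (v 2)) ↔ _
    constructor
    · intro h
      obtain ⟨ha, hb, -⟩ := hS.F_sort _ _ _ h
      have e0 : v 0 = Sum.inl ⟨_, ha⟩ := hE.1 rfl
      have e1 : v 1 = Sum.inl ⟨_, hb⟩ := hE.1 rfl
      refine ⟨_, _, e0, e1, hE.1 ?_⟩
      exact hS.F_unique _ _ _ _ h (hg ⟨_, ha⟩ ⟨_, hb⟩)
    · rintro ⟨x, y, h0, h1, h2⟩
      rw [h0, h1, h2]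
      exact hg x y
  | Q =>
    rw [h3 (E ∘ v), relMap_Q_iff]
    change p12Q (E (v 0)) (E (v 1)) (E (v 2)) ↔ _
    constructor
    · intro h
      obtain ⟨ha, hb, -⟩ := hS.Q_sort _ _ _ h
      have e0 : v 0 = Sum.inl ⟨_, ha⟩ := hE.1 rfl
      have e1 : v 1 = Sum.inl ⟨_, hb⟩ := hE.1 rfl
      refine ⟨_, _, e0, e1, hE.1 ?_⟩
      exact hS.Q_unique _ _ _ _ h (hQ ⟨_, ha⟩ ⟨_, hb⟩)
    · rintro ⟨x, y, h0, h1, h2⟩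
      rw [h0, h1, h2]
      exact hQ x y

/-- Every model of `T12 M₀` is isomorphic to the standard structure on a model of `T0`. -/
theorem exists_model_equiv {T0 : Lf.Theory} {M₀ : Type w} [Lf.Structure M₀] (hM₀ : T0.Model M₀)
    (N : Type w) [L12.Structure N] [(T12 M₀).Model N] :
    ∃ (X : Type w) (_ : Lf.Structure X), T0.Model X ∧ Nonempty ((X ⊕ Sym2 X) ≃[L12] N) := by
  have : N ⊨ L12.completeTheory (M₀ ⊕ Sym2 M₀) := ‹(T12 M₀).Model N›
  have hequiv : (M₀ ⊕ Sym2 M₀) ≅[L12] N := elementarilyEquivalent_iff.2 fun φ =>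
    (realize_iff_of_model_completeTheory (M₀ ⊕ Sym2 M₀) N φ).symm
  obtain ⟨X, _, ⟨e⟩⟩ := ((isPairing_standard M₀).of_equivalent hequiv).exists_equiv
  refine ⟨X, _, ⟨fun φ hφ => ?_⟩, ⟨e⟩⟩
  obtain ⟨ψ, hψ⟩ := exists_relativization.{w} φ
  let χ : L12.Formula (Fin 0) := ψ.relabel (Sum.elim (fun a : Empty => a.elim) id)
  have hχ : ∀ (Y : Type w) [Lf.Structure Y] (v : Fin 0 → Y ⊕ Sym2 Y), χ.Realize v ↔ Y ⊨ φ := by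
    intro Y _ v
    have h := hψ Y (fun i => (Sum.elim (fun a : Empty => a.elim) Fin.elim0 i : Y))
    rw [Formula.realize_relabel, Subsingleton.elim (v ∘ _) (Sum.inl ∘ fun i =>
      (Sum.elim (fun a : Empty => a.elim) Fin.elim0 i : Y)), h, Sentence.Realize, Formula.Realize]
    rw [Subsingleton.elim (_ ∘ Sum.inl) (default : Empty → Y),
      Subsingleton.elim (_ ∘ Sum.inr) (default : Fin 0 → Y)]
  have h1 : ∀ v : Fin 0 → M₀ ⊕ Sym2 M₀, χ.Realize v := fun v =>
    (hχ M₀ v).2 (Theory.realize_sentence_of_mem T0 hφ)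
  have h2 := forall_realize_of_equivalent (hequiv.trans
    (StrongHomClass.elementarilyEquivalent e.symm)) χ h1 Fin.elim0
  exact (hχ X _).1 h2

end Decomposition

section Realization

theorem IsMonster.exists_realize {S : Type w} [L12.Structure S] [Nonempty S] {κ : Cardinal.{w}}
    (hS : IsMonster L12 S κ) {C : Set S} (hC : #C < κ) {ι : Type w} (hι : #ι < κ)
    {R : Type w} [L12.Structure R] (G : S → R)
    (hG : ∀ φ : L12.Formula S, φ.Realize G ↔ φ.Realize id) (y : ι → R) :
    ∃ x : ι → S, ∀ (n : ℕ) (φ : L12.Formula (ι ⊕ Fin n)) (c : Fin n → S), (∀ i, c i ∈ C) →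
      φ.Realize (Sum.elim y (G ∘ c)) → φ.Realize (Sum.elim x c) := by
  classical
  suffices h : ∀ s : Finset ((n : ℕ) × L12.Formula (ι ⊕ Fin n) × (Fin n → S)),
      (∀ q ∈ s, q.2.1.Realize (Sum.elim y (G ∘ q.2.2))) →
      ∃ x : ι → S, ∀ q ∈ s, q.2.1.Realize (Sum.elim x q.2.2) by
    obtain ⟨x, hx⟩ := hS.saturated C hC hι
      {q | (∀ i, q.2.2 i ∈ C) ∧ q.2.1.Realize (Sum.elim y (G ∘ q.2.2))} (fun q hq => hq.1)
      fun s hs => h s fun q hq => (hs hq).2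
    exact ⟨x, fun n φ c hc h => hx ⟨n, φ, c⟩ ⟨hc, h⟩⟩
  intro s hs
  let ψ : L12.Formula (ι ⊕ S) := Formula.iInf fun q : s => q.1.2.1.relabel (Sum.map id q.1.2.2)
  have hψ : ∀ {R : Type w} [L12.Structure R] (x : ι → R) (g : S → R),
      ψ.Realize (Sum.elim x g) ↔ ∀ q ∈ s, q.2.1.Realize (Sum.elim x (g ∘ q.2.2)) := by
    intro R _ x g
    simp only [ψ, Formula.realize_iInf, Formula.realize_relabel, Sum.elim_comp_map,
      Function.comp_id, Subtype.forall]
  obtain ⟨n, j, θ, hθ⟩ := exists_formula_fin.{w} ψ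
  let T := {t : ι // ∃ i, j i = Sum.inl t}
  have : Finite T := by
    refine Finite.of_injective (β := Fin n) (fun t => t.2.choose) fun t t' h => ?_
    have h1 := t.2.choose_spec
    have h2 := t'.2.choose_spec
    simp only at h
    rw [h, h2] at h1
    exact Subtype.ext (Sum.inl.inj h1).symm
  have hh : ∀ i, ∃ z : S ⊕ T, Sum.elim (fun t : T => Sum.inl t.1) Sum.inr z.swap = j i := by
    intro i
    rcases hj : j i with t | c
    · exact ⟨Sum.inr ⟨t, i, hj⟩, rfl⟩
    · exact ⟨Sum.inl c, rfl⟩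
  choose h hh using hh
  have key : ∀ {R : Type w} [L12.Structure R] (x : ι → R) (g : S → R),
      Sum.elim g (fun t : T => x t) ∘ h = Sum.elim x g ∘ j := by
    intro R _ x g
    funext i
    rw [Function.comp_apply, Function.comp_apply, ← hh i]
    rcases h i with c | t <;> rfl
  have h1 : ((θ.relabel h).iExs T).Realize G := by
    rw [Formula.realize_iExs]
    refine ⟨fun t => y t, ?_⟩
    rw [Formula.realize_relabel, key, hθ, hψ]
    exact hs
  rw [hG, Formula.realize_iExs] at h1
  obtain ⟨z, hz⟩ := h1
  obtain ⟨x, hx⟩ : ∃ x : ι → S, (fun t : T => x t) = z :=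
    ⟨fun t => if ht : ∃ i, j i = Sum.inl t then z ⟨t, ht⟩ else Classical.arbitrary S,
      funext fun t => dif_pos t.2⟩
  rw [← hx, Formula.realize_relabel, key, hθ, hψ] at hz
  exact ⟨x, hz⟩

theorem realize_map_iff_of_op {T0 : Lf.Theory} (hT0 : IsModelCompletionOfEmptyTheory.{u} T0)
    {A B C : Type w} [Lf.Structure B] [Lf.Structure C]
    (hB : T0.Model B) (hC : T0.Model C) (op : A → A → A) {g : A → B} {g' : A → C}
    (hg : Function.Injective g) (hg' : Function.Injective g')
    (hop : ∀ x y, g (op x y) = fop (g x) (g y)) (hop' : ∀ x y, g' (op x y) = fop (g' x) (g' y))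
    {α : Type*} (φ : L12.Formula α) (v : α → A ⊕ Sym2 A) :
    φ.Realize (Sum.map g (Sym2.map g) ∘ v) ↔ φ.Realize (Sum.map g' (Sym2.map g') ∘ v) := by
  let inst : Lf.Structure A :=
    { funMap := fun {n} s => match n, s with
        | _, Fn12.f => fun v => op (v 0) (v 1)
      RelMap := fun r _ => r.elim }
  exact realize_map_iff_of_embeddings hT0 hB hC
    ⟨⟨g, hg⟩, fun {n} s v => by
      cases s; exact (hop _ _).trans (funMap_eq_fop (g ∘ v)).symm, fun r => r.elim⟩
    ⟨⟨g', hg'⟩, fun {n} s v => by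
      cases s; exact (hop' _ _).trans (funMap_eq_fop (g' ∘ v)).symm, fun r => r.elim⟩ φ v

theorem exists_model_of_op {T0 : Lf.Theory} (hT0 : IsModelCompletionOfEmptyTheory.{u} T0)
    {A : Type w} [Nonempty A] (op : A → A → A) :
    ∃ (B : Type w) (_ : Lf.Structure B) (g : A → B), T0.Model B ∧ Function.Injective g ∧
      ∀ x y, g (op x y) = fop (g x) (g y) := by
  let inst : Lf.Structure A :=
    { funMap := fun {n} s => match n, s with
        | _, Fn12.f => fun v => op (v 0) (v 1)
      RelMap := fun r _ => r.elim }
  obtain ⟨B, _, hB, ⟨g⟩⟩ := exists_embedding_model hT0 A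
  refine ⟨B, _, g, hB, g.injective, fun x y => ?_⟩
  exact (g.map_fun (Fn12.f : Lf.Functions 2) ![x, y]).trans (funMap_eq_fop (g ∘ ![x, y]))

/-- An extension of `X` to a model of `T0` gives an elementary extension of the two-sorted
structure. -/
theorem realize_extension_iff {T0 : Lf.Theory} (hT0 : IsModelCompletionOfEmptyTheory.{u} T0)
    {X B : Type w} [Lf.Structure X] [Lf.Structure B] (hX : T0.Model X) (hB : T0.Model B)
    {S : Type w} [L12.Structure S] (e : (X ⊕ Sym2 X) ≃[L12] S) {g : X → B}
    (hg : Function.Injective g) (hop : ∀ x y, g (fop x y) = fop (g x) (g y))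
    (φ : L12.Formula S) :
    φ.Realize (Sum.map g (Sym2.map g) ∘ e.symm) ↔ φ.Realize (id : S → S) := by
  rw [realize_map_iff_of_op hT0 hB hX fop (g' := id) hg Function.injective_id hop fun _ _ => rfl]
  have := StrongHomClass.realize_formula e.symm φ (v := id)
  rw [← this]
  simp

end Realization

section Pattern

/-- The map on two-sorted structures induced by a map of home sorts. -/
abbrev mapPairs {A B : Type w} (g : A → B) : A ⊕ Sym2 A → B ⊕ Sym2 B := Sum.map g (Sym2.map g)

/-- A family `c` of distinct elements outside the range of `j` that is closed under `f`, with
multiplication table `T`, and absorbs the range of `j`. -/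
structure IsPattern {A Y : Type w} [Lf.Structure Y] {K : Type} (j : A → Y) (T : K → K → K)
    (c : K → Y) : Prop where
  injective : Function.Injective c
  ne : ∀ a k, j a ≠ c k
  op : ∀ k k', fop (c k) (c k') = c (T k k')
  op_left : ∀ a k, fop (j a) (c k) = c k
  op_right : ∀ a k, fop (c k) (j a) = c k

/-- Families with the same multiplication table have the same type over the base. -/
theorem IsPattern.realize_iff {T0 : Lf.Theory} (hT0 : IsModelCompletionOfEmptyTheory.{u} T0)
    {A Y Z : Type w} [Lf.Structure Y] [Lf.Structure Z] (hY : T0.Model Y) (hZ : T0.Model Z)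
    {op : A → A → A} {j : A → Y} {j' : A → Z}
    (hj : Function.Injective j) (hj' : Function.Injective j')
    (hop : ∀ x y, j (op x y) = fop (j x) (j y)) (hop' : ∀ x y, j' (op x y) = fop (j' x) (j' y))
    {K : Type} {T : K → K → K} {c : K → Y} {c' : K → Z}
    (hc : IsPattern j T c) (hc' : IsPattern j' T c')
    {α : Type*} (φ : L12.Formula α) (v : α → (A ⊕ K) ⊕ Sym2 (A ⊕ K)) :
    φ.Realize (mapPairs (Sum.elim j c) ∘ v) ↔ φ.Realize (mapPairs (Sum.elim j' c') ∘ v) := by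
  let op' : A ⊕ K → A ⊕ K → A ⊕ K := fun p q =>
    Sum.elim (fun x => Sum.elim (fun y => Sum.inl (op x y)) Sum.inr q)
      (fun k => Sum.elim (fun _ => Sum.inr k) (fun k' => Sum.inr (T k k')) q) p
  have key : ∀ {Y : Type w} [Lf.Structure Y] {j : A → Y} {c : K → Y} (_ : IsPattern j T c)
      (_ : Function.Injective j) (_ : ∀ x y, j (op x y) = fop (j x) (j y)),
      Function.Injective (Sum.elim j c) ∧
        ∀ p q, Sum.elim j c (op' p q) = fop (Sum.elim j c p) (Sum.elim j c q) := by
    intro Y _ j c hc hj hop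
    refine ⟨hj.sumElim hc.injective hc.ne, ?_⟩
    rintro (x | k) (y | k')
    · exact hop x y
    · exact (hc.op_left x k').symm
    · exact (hc.op_right y k).symm
    · exact (hc.op k k').symm
  exact realize_map_iff_of_op hT0 hY hZ op' (key hc hj hop).1 (key hc' hj' hop').1
    (key hc hj hop).2 (key hc' hj' hop').2 φ v

end Pattern

section Base

theorem exists_realize_elementarySubstructure {S : Type w} [L12.Structure S]
    (R : L12.ElementarySubstructure S) {n m : ℕ} (φ : L12.Formula (Fin n ⊕ Fin m))
    (x : Fin n → R) (h : ∃ z : Fin m → S, φ.Realize (Sum.elim ((↑) ∘ x) z)) :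
    ∃ z : Fin m → R, φ.Realize (Sum.elim ((↑) ∘ x) ((↑) ∘ z) : Fin n ⊕ Fin m → S) := by
  rw [← Formula.realize_iExs] at h
  have h := (R.isElementary (φ.iExs (Fin m)) x).1 h
  rw [Formula.realize_iExs] at h
  obtain ⟨z, hz⟩ := h
  refine ⟨z, ?_⟩
  rw [← Sum.comp_elim]
  exact (R.subtype.map_formula φ (Sum.elim x z)).2 hz

variable {X N : Type w} [Lf.Structure X] [L12.Structure N] (e : (X ⊕ Sym2 X) ≃[L12] N)

theorem p12O_equiv (a : N) : p12O a ↔ ∃ x, a = e (Sum.inl x) := by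
  obtain ⟨a, rfl⟩ := e.surjective a
  rw [p12O_map, p12O_iff]
  simp

theorem p12F_equiv (x y z : X) :
    p12F (e (Sum.inl x)) (e (Sum.inl y)) (e (Sum.inl z)) ↔ fop x y = z := by
  rw [p12F_map, p12F_iff]
  constructor
  · rintro ⟨_, _, h1, h2, h3⟩
    rw [Sum.inl.inj h1, Sum.inl.inj h2, Sum.inl.inj h3]
  · rintro rfl
    exact ⟨x, y, rfl, rfl, rfl⟩

theorem p12F_equiv' (x y : X) (c : N) :
    p12F (e (Sum.inl x)) (e (Sum.inl y)) c ↔ c = e (Sum.inl (fop x y)) := by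
  obtain ⟨c, rfl⟩ := e.surjective c
  rw [p12F_map, p12F_iff, e.injective.eq_iff]
  constructor
  · rintro ⟨_, _, h1, h2, h3⟩
    rw [Sum.inl.inj h1, Sum.inl.inj h2, h3]
  · rintro rfl
    exact ⟨x, y, rfl, rfl, rfl⟩

theorem p12Q_equiv (x y : X) (c : N) :
    p12Q (e (Sum.inl x)) (e (Sum.inl y)) c ↔ c = e (Sum.inr s(x, y)) := by
  obtain ⟨c, rfl⟩ := e.surjective c
  rw [p12Q_map, p12Q_iff, e.injective.eq_iff]
  constructor
  · rintro ⟨_, _, h1, h2, h3⟩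
    rw [Sum.inl.inj h1, Sum.inl.inj h2, h3]
  · rintro rfl
    exact ⟨x, y, rfl, rfl, rfl⟩

theorem p12Q_iff_exists (a b c : N) : p12Q a b c ↔
    ∃ x y, a = e (Sum.inl x) ∧ b = e (Sum.inl y) ∧ c = e (Sum.inr s(x, y)) := by
  obtain ⟨a, rfl⟩ := e.surjective a
  obtain ⟨b, rfl⟩ := e.surjective b
  obtain ⟨c, rfl⟩ := e.surjective c
  simp only [p12Q_map, p12Q_iff, e.injective.eq_iff]

theorem p12F_iff_exists (a b c : N) : p12F a b c ↔
    ∃ x y, a = e (Sum.inl x) ∧ b = e (Sum.inl y) ∧ c = e (Sum.inl (fop x y)) := by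
  obtain ⟨a, rfl⟩ := e.surjective a
  obtain ⟨b, rfl⟩ := e.surjective b
  obtain ⟨c, rfl⟩ := e.surjective c
  simp only [p12F_map, p12F_iff, e.injective.eq_iff]

/-- The home sort of a substructure. -/
def homeSet (R : L12.ElementarySubstructure N) : Set X := {x | e (Sum.inl x) ∈ R}

variable (R : L12.ElementarySubstructure N)

theorem fop_mem_homeSet {x y : X} (hx : x ∈ homeSet e R) (hy : y ∈ homeSet e R) :
    fop x y ∈ homeSet e R := by
  obtain ⟨z, hz⟩ := exists_realize_elementarySubstructure R
    (fmF (Sum.inl 0) (Sum.inl 1) (Sum.inr 0) : L12.Formula (Fin 2 ⊕ Fin 1))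
    ![⟨_, hx⟩, ⟨_, hy⟩] ⟨![e (Sum.inl (fop x y))], by
      rw [realize_fmF]
      exact (p12F_equiv e x y _).2 rfl⟩
  rw [realize_fmF] at hz
  have := (p12F_equiv' e x y (z 0)).1 hz
  rw [homeSet, mem_ofPred_eq, ← this]
  exact (z 0).2

theorem exists_mapPairs_eq {c : N} (hc : c ∈ R) :
    ∃ t : homeSet e R ⊕ Sym2 (homeSet e R), c = e (mapPairs (↑) t) := by
  obtain ⟨c, rfl⟩ := e.surjective c
  rcases c with x | s
  · exact ⟨Sum.inl ⟨x, hc⟩, rfl⟩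
  · induction s with
    | _ x y =>
      obtain ⟨z, hz⟩ := exists_realize_elementarySubstructure R
        (fmQ (Sum.inr 0) (Sum.inr 1) (Sum.inl 0) : L12.Formula (Fin 1 ⊕ Fin 2))
        ![⟨_, hc⟩] ⟨![e (Sum.inl x), e (Sum.inl y)], by
          rw [realize_fmQ]
          exact (p12Q_equiv e x y _).2 rfl⟩
      rw [realize_fmQ] at hz
      obtain ⟨x', y', h1, h2, h3⟩ := (p12Q_iff_exists e (z 0 : N) (z 1) _).1 hz
      refine ⟨Sum.inr s(⟨x', ?_⟩, ⟨y', ?_⟩), h3⟩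
      · rw [homeSet, mem_ofPred_eq, ← h1]; exact (z 0).2
      · rw [homeSet, mem_ofPred_eq, ← h2]; exact (z 1).2

end Base

section Sequence

variable {T0 : Lf.Theory} {X N : Type w} [Lf.Structure X] [L12.Structure N]

theorem IsPattern.comp {A : Type w} {K K' : Type} {j : A → X} {c : K → X}
    (hc : IsPattern j (fun k _ => k) c) {g : K' → K} (hg : Function.Injective g) :
    IsPattern j (fun k _ => k) (c ∘ g) where
  injective := hc.injective.comp hg
  ne a k := hc.ne a (g k)
  op k k' := hc.op (g k) (g k')
  op_left a k := hc.op_left a (g k)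
  op_right a k := hc.op_right a (g k)

theorem IsPattern.sameType (hT0 : IsModelCompletionOfEmptyTheory.{u} T0) (hX : T0.Model X)
    (e : (X ⊕ Sym2 X) ≃[L12] N) (R : L12.ElementarySubstructure N)
    {K : Type} {T : K → K → K} {c c' : K → X}
    (hc : IsPattern ((↑) : homeSet e R → X) T c) (hc' : IsPattern ((↑) : homeSet e R → X) T c')
    {ι : Type*} (v : ι → (homeSet e R ⊕ K) ⊕ Sym2 (homeSet e R ⊕ K)) :
    SameType L12 N R (e ∘ mapPairs (Sum.elim (↑) c) ∘ v) (e ∘ mapPairs (Sum.elim (↑) c') ∘ v) := by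
  intro n φ p hp
  choose t ht using fun i => exists_mapPairs_eq e R (hp i)
  have h : ∀ c : K → X, Sum.elim (e ∘ mapPairs (Sum.elim (↑) c) ∘ v) p =
      e ∘ mapPairs (Sum.elim ((↑) : homeSet e R → X) c) ∘ Sum.elim v (mapPairs Sum.inl ∘ t) := by
    intro c
    funext i
    rcases i with i | i
    · rfl
    simp only [Sum.elim_inr, ht, Function.comp_apply]
    rcases t i with x | s
    · rfl
    · induction s with
      | _ x y => rfl
  rw [h, h, StrongHomClass.realize_formula, StrongHomClass.realize_formula]
  exact IsPattern.realize_iff hT0 hX hX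
    (op := fun x y => ⟨fop x.1 y.1, fop_mem_homeSet e R x.2 y.2⟩) Subtype.val_injective
    Subtype.val_injective (fun _ _ => rfl) (fun _ _ => rfl) hc hc' φ _

/-- Saturation for quantifier-free conditions on tuples of the home sort: any such tuple in an
extension of the home sort can be found in the home sort itself. -/
theorem exists_home_realize (hT0 : IsModelCompletionOfEmptyTheory.{u} T0) (hX : T0.Model X)
    (e : (X ⊕ Sym2 X) ≃[L12] N) {κ : Cardinal.{w}} (hN : IsMonster L12 N κ) [Nonempty X]
    {Y : Type w} (op : Y → Y → Y) {h : X → Y} (hh : Function.Injective h)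
    (hop : ∀ x y, h (fop x y) = op (h x) (h y)) {C : Set X} (hC : #C < κ)
    {ι : Type w} (hι : #ι < κ) (z : ι → Y) :
    ∃ E : ι → X, (∀ p q, z p ≠ z q → E p ≠ E q) ∧
      (∀ p q r, op (z p) (z q) = z r → fop (E p) (E q) = E r) ∧
      ∀ p, ∀ x ∈ C, z p = h x → E p = x := by
  have : Nonempty Y := Nonempty.map h ‹_›
  have : Nonempty N := Nonempty.map (e ∘ Sum.inl) ‹Nonempty X›
  obtain ⟨B, _, g, hB, hg, hgop⟩ := exists_model_of_op hT0 op
  obtain ⟨y, hy⟩ := hN.exists_realize (C := (e ∘ Sum.inl) '' C) (mk_image_le.trans_lt hC) hι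
    (mapPairs (g ∘ h) ∘ e.symm)
    (realize_extension_iff hT0 hX hB e (hg.comp hh) fun x y => by simp [hop, hgop])
    fun i => Sum.inl (g (z i))
  have hy0 : ∀ φ : L12.Formula ι, φ.Realize (fun i => (Sum.inl (g (z i)) : B ⊕ Sym2 B)) →
      φ.Realize y := by
    intro φ hφ
    have := hy 0 (φ.relabel Sum.inl) Fin.elim0 (fun i => i.elim0) (by
      rwa [Formula.realize_relabel, Sum.elim_comp_inl])
    rwa [Formula.realize_relabel, Sum.elim_comp_inl] at this
  have hyO : ∀ i, ∃ x, y i = e (Sum.inl x) := by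
    intro i
    rw [← p12O_equiv]
    exact (realize_fmO _ _).1 (hy0 (fmO i) ((realize_fmO _ _).2 ⟨_, rfl⟩))
  choose E hE using hyO
  refine ⟨E, fun p q hpq h => ?_, fun p q r hpqr => ?_, fun p x hx hp => ?_⟩
  · have := hy0 (fmE p q).not (by
      rw [Formula.realize_not, realize_fmE]
      exact fun h => hpq (hg (Sum.inl.inj h)))
    rw [Formula.realize_not, realize_fmE, hE, hE, h] at this
    exact this rfl
  · rw [← p12F_equiv e, ← hE, ← hE, ← hE, ← realize_fmF]
    refine hy0 _ ((realize_fmF _ _ _ _).2 ?_)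
    exact (p12F_equiv (FirstOrder.Language.Equiv.refl L12 (B ⊕ Sym2 B)) _ _ _).2 (by rw [← hgop, hpqr])
  · have := hy 1 (fmE (Sum.inl p) (Sum.inr 0)) (fun _ => e (Sum.inl x))
      (fun _ => ⟨x, hx, rfl⟩) ((realize_fmE _ _ _).2 (by simp [hp]))
    rw [realize_fmE] at this
    simpa [hE] using this

theorem exists_isPattern_seq (hT0 : IsModelCompletionOfEmptyTheory.{u} T0) (hX : T0.Model X)
    (e : (X ⊕ Sym2 X) ≃[L12] N) (R : L12.ElementarySubstructure N)
    {κ : Cardinal.{w}} (hN : IsMonster L12 N κ) (hR : #(R : Set N) < κ) {x₁ x₂ : X}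
    (hx : IsPattern ((↑) : homeSet e R → X) (fun k _ => k) ![x₁, x₂]) :
    ∃ E : ℕ → X, E 0 = x₁ ∧ IsPattern ((↑) : homeSet e R → X) (fun k _ => k)
      (fun o : Option ℕ => o.elim x₂ E) := by
  classical
  let S := homeSet e R
  have hne : x₁ ≠ x₂ := fun h => by simpa using hx.injective (a₁ := 0) (a₂ := 1) h
  have hx₁ : x₁ ∉ S := fun h => hx.ne ⟨_, h⟩ 0 rfl
  have hx₂ : x₂ ∉ S := fun h => hx.ne ⟨_, h⟩ 1 rfl
  let op : X ⊕ ℕ → X ⊕ ℕ → X ⊕ ℕ := fun p q =>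
    Sum.elim (fun x => Sum.elim (fun y => Sum.inl (fop x y))
      (fun i => if x ∈ S then Sum.inr i else Sum.inl x) q) Sum.inr p
  let z : Option ℕ → X ⊕ ℕ := fun o =>
    o.elim (Sum.inl x₂) fun i => Nat.casesOn i (Sum.inl x₁) Sum.inr
  have hz : Function.Injective z := by
    rintro (_ | _ | i) (_ | _ | j) h <;> simp_all [z]
  have hzz : ∀ i j, op (z i) (z j) = z i := by
    rintro (_ | _ | i) (_ | _ | j)
    · exact congrArg _ (hx.op 1 1)
    · exact congrArg _ (hx.op 1 0)
    · exact if_neg hx₂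
    · exact congrArg _ (hx.op 0 1)
    · exact congrArg _ (hx.op 0 0)
    · exact if_neg hx₁
    all_goals rfl
  have hzm : ∀ i, ∀ m : S, op (z i) (Sum.inl m) = z i := by
    rintro (_ | _ | i) m
    · exact congrArg _ (hx.op_right m 1)
    · exact congrArg _ (hx.op_right m 0)
    · rfl
  have hmz : ∀ i, ∀ m : S, op (Sum.inl m) (z i) = z i := by
    rintro (_ | _ | i) m
    · exact congrArg _ (hx.op_left m 1)
    · exact congrArg _ (hx.op_left m 0)
    · exact if_pos m.2
  have hzm' : ∀ i, ∀ m : S, Sum.inl (m : X) ≠ z i := by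
    rintro (_ | _ | i) m h
    · exact hx₂ (Sum.inl.inj h ▸ m.2)
    · exact hx₁ (Sum.inl.inj h ▸ m.2)
    · cases h
  have hS : #S < κ := (mk_le_of_injective (f := fun x : S => (⟨_, x.2⟩ : (R : Set N)))
    fun x y h => by simpa [Subtype.ext_iff] using h).trans_lt hR
  have hC : #(S ∪ {x₁, x₂} : Set X) < κ := (mk_union_le _ _).trans_lt
    (add_lt_of_lt hN.aleph0_lt.le hS ((Set.Finite.lt_aleph0 (by simp)).trans hN.aleph0_lt))
  have hι : #(ULift.{w} (Option ℕ) ⊕ S) < κ := by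
    rw [mk_sum, lift_id, lift_id]
    exact add_lt_of_lt hN.aleph0_lt.le (by simpa using hN.aleph0_lt) hS
  have : Nonempty X := ⟨x₁⟩
  obtain ⟨E, hE1, hE2, hE3⟩ := exists_home_realize hT0 hX e hN op Sum.inl_injective
    (fun _ _ => rfl) hC hι (Sum.elim (fun i => z i.down) fun m => Sum.inl m)
  have hEm : ∀ m, E (Sum.inr m) = m := fun m => hE3 _ _ (Or.inl m.2) rfl
  have hEo : ∀ o : Option ℕ, o.elim x₂ (fun i => E (Sum.inl ⟨some i⟩)) = E (Sum.inl ⟨o⟩) := by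
    rintro (_ | i)
    · exact (hE3 _ _ (by simp) rfl).symm
    · rfl
  refine ⟨fun i => E (Sum.inl ⟨some i⟩), hE3 _ _ (by simp) rfl, ⟨fun o o' h => ?_, fun m o => ?_,
    fun o o' => ?_, fun m o => ?_, fun m o => ?_⟩⟩
  · rw [hEo, hEo] at h
    by_contra hoo
    exact hE1 (Sum.inl ⟨o⟩) (Sum.inl ⟨o'⟩) (hz.ne hoo) h
  · rw [hEo, ← hEm]
    exact hE1 (Sum.inr m) (Sum.inl ⟨o⟩) (hzm' o m)
  · rw [hEo, hEo]
    exact hE2 (Sum.inl ⟨o⟩) (Sum.inl ⟨o'⟩) (Sum.inl ⟨o⟩) (hzz o o')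
  · rw [hEo, ← hEm]
    exact hE2 (Sum.inr m) (Sum.inl ⟨o⟩) (Sum.inl ⟨o⟩) (hmz o m)
  · rw [hEo, ← hEm]
    exact hE2 (Sum.inl ⟨o⟩) (Sum.inr m) (Sum.inl ⟨o⟩) (hzm o m)

end Sequence

section Consequences

variable {T0 : Lf.Theory} {X N : Type w} [Lf.Structure X] [L12.Structure N]

theorem formulaDividesOver_of_isPattern (hT0 : IsModelCompletionOfEmptyTheory.{u} T0)
    (hX : T0.Model X) (e : (X ⊕ Sym2 X) ≃[L12] N) (R : L12.ElementarySubstructure N)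
    {κ : Cardinal.{w}} (hN : IsMonster L12 N κ) (hR : #(R : Set N) < κ) {x₁ x₂ : X}
    (hx : IsPattern ((↑) : homeSet e R → X) (fun k _ => k) ![x₁, x₂]) {ι : Type*} (t : ι) :
    FormulaDividesOver L12 N R (fmF (Sum.inl t) (Sum.inr 1) (Sum.inr 0) : L12.Formula (ι ⊕ Fin 2))
      ![e (Sum.inl x₁), e (Sum.inl x₂)] := by
  obtain ⟨E, hE0, hE⟩ := exists_isPattern_seq hT0 hX e R hN hR hx
  refine ⟨fun i => ![e (Sum.inl (E i)), e (Sum.inl x₂)], 2, two_pos, by simp only [hE0], ?_, ?_⟩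
  · intro n s s' hs hs'
    have key : ∀ s : Fin n → ℕ, (fun p : Fin n × Fin 2 =>
        (![e (Sum.inl (E (s p.1))), e (Sum.inl x₂)] : Fin 2 → N) p.2) =
        e ∘ mapPairs (Sum.elim ((↑) : homeSet e R → X)
          ((fun o : Option ℕ => o.elim x₂ E) ∘ Option.map s)) ∘
          fun p => Sum.inl (Sum.inr (if p.2 = 0 then some p.1 else none)) := by
      intro s
      funext ⟨i, j⟩
      fin_cases j <;> rfl
    rw [key, key]
    exact IsPattern.sameType hT0 hX e R (hE.comp (Option.map_injective hs.injective))
      (hE.comp (Option.map_injective hs'.injective)) _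
  · rintro s hs ⟨x, hx⟩
    obtain ⟨i, j, hij, rfl⟩ := Finset.card_eq_two.1 hs
    have h1 := hx i (by simp)
    have h2 := hx j (by simp)
    rw [realize_fmF] at h1 h2
    obtain ⟨y, -, hy, -⟩ := (p12F_iff_exists e _ _ _).1 h1
    simp only [Sum.elim_inl] at hy
    have h3 : fop y x₂ = E i := by simpa [hy, p12F_equiv] using h1
    have h4 : fop y x₂ = E j := by simpa [hy, p12F_equiv] using h2
    exact hij (Option.some_injective _ (hE.injective (h3.symm.trans h4)))

/-- `d₁` is not algebraic over `M ∪ {d₂}`. -/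
theorem not_mem_acl_of_isPattern (hT0 : IsModelCompletionOfEmptyTheory.{u} T0)
    (hX : T0.Model X) (e : (X ⊕ Sym2 X) ≃[L12] N) (R : L12.ElementarySubstructure N)
    {κ : Cardinal.{w}} (hN : IsMonster L12 N κ) (hR : #(R : Set N) < κ) {x₁ x₂ : X}
    (hx : IsPattern ((↑) : homeSet e R → X) (fun k _ => k) ![x₁, x₂]) :
    e (Sum.inl x₁) ∉ acl L12 N (R ∪ {e (Sum.inl x₂)}) := by
  obtain ⟨E, hE0, hE⟩ := exists_isPattern_seq hT0 hX e R hN hR hx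
  rintro ⟨n, φ, c, hc, h, hfin⟩
  have hEinj : Function.Injective fun i => e (Sum.inl (E i)) := fun i j h =>
    Option.some_injective _ (hE.injective (Sum.inl_injective (e.injective h)))
  refine infinite_of_injective_forall_mem hEinj (fun i => ?_) hfin
  have hEi : IsPattern ((↑) : homeSet e R → X) (fun k _ => k) ![E i, x₂] := by
    convert hE.comp (g := (![some i, none] : Fin 2 → Option ℕ)) ?_ using 1
    · funext k
      fin_cases k <;> rfl
    · intro k l h
      fin_cases k <;> fin_cases l <;> simp_all
  have hrep : ∀ l, ∃ t : (homeSet e R ⊕ Fin 2) ⊕ Sym2 (homeSet e R ⊕ Fin 2), ∀ x : X,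
      c l = e (mapPairs (Sum.elim (↑) ![x, x₂]) t) := by
    intro l
    rcases hc l with h | h
    · obtain ⟨t, ht⟩ := exists_mapPairs_eq e R h
      refine ⟨mapPairs Sum.inl t, fun x => ?_⟩
      rw [ht]
      rcases t with x | s
      · rfl
      · induction s with
        | _ x y => rfl
    · exact ⟨Sum.inl (Sum.inr 1), fun _ => h⟩
  choose t ht using hrep
  have key : ∀ x : X, (Fin.cons (e (Sum.inl x)) c : Fin (n + 1) → N) =
      e ∘ mapPairs (Sum.elim ((↑) : homeSet e R → X) ![x, x₂]) ∘
        Fin.cons (Sum.inl (Sum.inr 0)) t := by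
    intro x
    funext l
    refine Fin.cases rfl (fun l => ?_) l
    exact ht l x
  rw [key] at h
  rw [mem_ofPred_eq, key]
  have := IsPattern.sameType hT0 hX e R hx hEi (Fin.cons (Sum.inl (Sum.inr 0)) t) 0
    (φ.relabel Sum.inl) Fin.elim0 (fun i => i.elim0)
  rw [Formula.realize_relabel, Formula.realize_relabel, Sum.elim_comp_inl,
    Sum.elim_comp_inl] at this
  exact this.1 h

end Consequences

section Acl

variable {N : Type w} [L12.Structure N]

theorem subset_acl (C : Set N) : C ⊆ acl L12 N C := fun c hc =>
  ⟨1, fmE 0 1, fun _ => c, fun _ => hc, (realize_fmE _ _ _).2 rfl, by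
    simp only [realize_fmE]
    exact (finite_singleton c).subset fun x hx => hx⟩

theorem mem_acl_of_p12F {X : Type w} [Lf.Structure X] (e : (X ⊕ Sym2 X) ≃[L12] N) {C : Set N}
    {x y : X} (hx : e (Sum.inl x) ∈ C) (hy : e (Sum.inl y) ∈ C) :
    e (Sum.inl (fop x y)) ∈ acl L12 N C := by
  refine ⟨2, fmF 1 2 0, ![e (Sum.inl x), e (Sum.inl y)], fun i => ?_, ?_, ?_⟩
  · fin_cases i <;> assumption
  · exact (realize_fmF _ _ _ _).2 ((p12F_equiv e _ _ _).2 rfl)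
  · simp only [realize_fmF]
    exact (finite_singleton _).subset fun z hz => (p12F_equiv' e x y z).1 hz

theorem mem_acl_of_p12Q {X : Type w} [Lf.Structure X] (e : (X ⊕ Sym2 X) ≃[L12] N) {C : Set N}
    {x y : X} (h : e (Sum.inr s(x, y)) ∈ C) : e (Sum.inl x) ∈ acl L12 N C := by
  refine ⟨1, (fmQ (Sum.inl 0) (Sum.inr ()) (Sum.inl 1) : L12.Formula (Fin 2 ⊕ Unit)).iExs Unit,
    ![e (Sum.inr s(x, y))], fun i => ?_, ?_, ?_⟩
  · fin_cases i
    exact h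
  · rw [Formula.realize_iExs]
    exact ⟨fun _ => e (Sum.inl y), (realize_fmQ _ _ _ _).2 ((p12Q_equiv e x y _).2 rfl)⟩
  · refine (toFinite {e (Sum.inl x), e (Sum.inl y)}).subset fun z hz => ?_
    rw [mem_ofPred_eq, Formula.realize_iExs] at hz
    obtain ⟨t, ht⟩ := hz
    rw [realize_fmQ, p12Q_iff_exists e] at ht
    obtain ⟨x', y', h1, -, h3⟩ := ht
    have h3 : s(x, y) = s(x', y') := Sum.inr_injective (e.injective h3)
    have h1 : z = e (Sum.inl x') := h1
    rw [h1]
    rcases Sym2.eq_iff.1 h3 with ⟨rfl, rfl⟩ | ⟨rfl, rfl⟩ <;> simp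

end Acl

section Pairs

/-- Among infinitely many pairs of distinct elements there are `k` that can be oriented such that
mapping the second component to the first is well defined, and no second component is a first
component. -/
theorem exists_orientation {X : Type*} (D₁ D₂ : ℕ → X) (hne : ∀ i, D₁ i ≠ D₂ i) (k : ℕ) :
    ∃ (s : Finset ℕ) (u v : ℕ → X), s.card = k ∧
      (∀ i, (u i = D₁ i ∧ v i = D₂ i) ∨ (u i = D₂ i ∧ v i = D₁ i)) ∧
      (∀ i ∈ s, ∀ j ∈ s, v i ≠ u j) ∧ ∀ i ∈ s, ∀ j ∈ s, v i = v j → u i = u j := by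
  classical
  by_cases hx : ∃ x, {i | D₁ i = x ∨ D₂ i = x}.Infinite
  · obtain ⟨x, hx⟩ := hx
    obtain ⟨s, hs, hsk⟩ := hx.exists_subset_card_eq k
    let u : ℕ → X := fun i => if D₂ i = x then D₂ i else D₁ i
    let v : ℕ → X := fun i => if D₂ i = x then D₁ i else D₂ i
    have hu : ∀ i ∈ s, u i = x := fun i hi => by
      have : D₁ i = x ∨ D₂ i = x := hs hi
      grind
    have hv : ∀ i, v i ≠ u i := fun i => by
      have := hne i
      grind
    refine ⟨s, u, v, hsk, fun i => by grind, fun i hi j hj => ?_, fun i hi j hj _ => ?_⟩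
    · rw [hu j hj, ← hu i hi]
      exact hv i
    · rw [hu i hi, hu j hj]
  · push Not at hx
    have hdisj : ∀ k, ∃ s : Finset ℕ, s.card = k ∧ ∀ i ∈ s, ∀ j ∈ s, i ≠ j →
        D₁ i ≠ D₁ j ∧ D₁ i ≠ D₂ j ∧ D₂ i ≠ D₂ j := by
      intro k
      induction k with
      | zero => exact ⟨∅, rfl, by simp⟩
      | succ k ih =>
        obtain ⟨s, hs, hd⟩ := ih
        have hfin : (⋃ i ∈ s, ({j | D₁ j = D₁ i ∨ D₂ j = D₁ i} ∪
            {j | D₁ j = D₂ i ∨ D₂ j = D₂ i})).Finite :=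
          s.finite_toSet.biUnion fun i _ => (hx _).union (hx _)
        obtain ⟨j, hj⟩ := hfin.exists_notMem
        simp only [mem_iUnion, mem_union, mem_ofPred_eq, not_exists] at hj
        have hjs : j ∉ s := fun h => hj j h (Or.inl (Or.inl rfl))
        refine ⟨insert j s, by rw [Finset.card_insert_of_notMem hjs, hs], fun i hi i' hi' h => ?_⟩
        rw [Finset.mem_insert] at hi hi'
        grind
    obtain ⟨s, hs, hd⟩ := hdisj k
    refine ⟨s, D₁, D₂, hs, fun i => Or.inl ⟨rfl, rfl⟩, fun i hi j hj => ?_, fun i hi j hj h => ?_⟩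
    · have := hne i
      have := hd j hj i hi
      grind
    · have := hd i hi j hj
      grind

end Pairs

section Dividing

variable {T0 : Lf.Theory} {X N : Type w} [Lf.Structure X] [L12.Structure N]

theorem SameType.comp {L : FirstOrder.Language} {M : Type*} [L.Structure M] {C : Set M}
    {ι ι' : Type*} {a b : ι → M} (h : SameType L M C a b) (g : ι' → ι) :
    SameType L M C (a ∘ g) (b ∘ g) := by
  intro n φ c hc
  have := h n (φ.relabel (Sum.map g id)) c hc
  simpa only [Formula.realize_relabel, Sum.elim_comp_map, Function.comp_id] using this

/-- The members of an indiscernible sequence of finite tuples are conjugate. -/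
theorem Indiscernible.exists_equiv {κ : Cardinal.{w}} (hN : IsMonster L12 N κ) {C : Set N}
    (hC : #C < κ) {m : ℕ} {bs : ℕ → Fin m → N} (h : Indiscernible L12 N C bs) (i : ℕ) :
    ∃ σ : N ≃[L12] N, (∀ c ∈ C, σ c = c) ∧ ∀ j, σ (bs 0 j) = bs i j := by
  have h1 := (h 1 (fun _ => 0) (fun _ => i) (Subsingleton.strictMono _)
    (Subsingleton.strictMono _)).comp fun j : ULift.{w} (Fin m) => ((0 : Fin 1), j.down)
  obtain ⟨σ, hσ, hσ'⟩ := hN.homogeneous C _ _ hC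
    ((lt_aleph0_of_finite _).trans hN.aleph0_lt) h1
  exact ⟨σ, hσ, fun j => hσ' ⟨j⟩⟩

theorem IsPattern.map_equiv {e : (X ⊕ Sym2 X) ≃[L12] N} {R : L12.ElementarySubstructure N}
    {K : Type} {T : K → K → K} {c : K → X}
    (hc : IsPattern ((↑) : homeSet e R → X) T c) {σ : N ≃[L12] N} (hσ : ∀ x ∈ R, σ x = x) :
    ∃ c' : K → X, (∀ k, σ (e (Sum.inl (c k))) = e (Sum.inl (c' k))) ∧
      IsPattern ((↑) : homeSet e R → X) T c' := by
  have h : ∀ k, ∃ x, σ (e (Sum.inl (c k))) = e (Sum.inl x) := fun k => by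
    rw [← p12O_equiv, p12O_map, p12O_equiv e]
    exact ⟨_, rfl⟩
  choose c' hc' using h
  have hinj : ∀ {x y : X}, e (Sum.inl x) = e (Sum.inl y) → x = y := fun h =>
    Sum.inl_injective (e.injective h)
  refine ⟨c', hc', fun k k' h => ?_, fun a k h => ?_, fun k k' => ?_, fun a k => ?_,
    fun a k => ?_⟩
  · apply hc.injective
    apply hinj
    apply σ.injective
    rw [hc', hc', h]
  · apply hc.ne a k
    apply hinj
    apply σ.injective
    rw [hc', ← h]
    exact hσ _ a.2
  · rw [← p12F_equiv e, ← hc', ← hc', ← hc', p12F_map, p12F_equiv]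
    exact hc.op k k'
  · have ha : σ (e (Sum.inl a)) = e (Sum.inl a) := hσ _ a.2
    rw [← p12F_equiv e, ← hc', ← ha, p12F_map, p12F_equiv]
    exact hc.op_left a k
  · have ha : σ (e (Sum.inl a)) = e (Sum.inl a) := hσ _ a.2
    rw [← p12F_equiv e, ← hc', ← ha, p12F_map, p12F_equiv]
    exact hc.op_right a k

/-- The multiplication table of `a, d₁, d₂`. -/
def tripleTable : Fin 3 → Fin 3 → Fin 3 := ![![0, 0, 1], ![0, 1, 1], ![1, 2, 2] ]

/-- For pairs that are oriented suitably, there is an element `a` of an extension that forms the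
pattern of `a, d₁, d₂` with each of them. -/
theorem exists_extension_isPattern (hT0 : IsModelCompletionOfEmptyTheory.{u} T0)
    {S : Set X} {s : Finset ℕ} {u v : ℕ → X}
    (huv : ∀ i, IsPattern ((↑) : S → X) (fun k _ => k) ![u i, v i])
    (hvu : ∀ i ∈ s, ∀ j ∈ s, v i ≠ u j) (hv : ∀ i ∈ s, ∀ j ∈ s, v i = v j → u i = u j) :
    ∃ (B : Type w) (_ : Lf.Structure B) (g : X → B) (z : B), T0.Model B ∧ Function.Injective g ∧
      (∀ x y, g (fop x y) = fop (g x) (g y)) ∧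
      ∀ i ∈ s, IsPattern (fun x : S => g x) tripleTable ![z, g (u i), g (v i)] := by
  classical
  let r : X → Option X := fun x => if h : ∃ i ∈ s, v i = x then some (u h.choose) else none
  have hr : ∀ i ∈ s, r (v i) = some (u i) := by
    intro i hi
    have h : ∃ j ∈ s, v j = v i := ⟨i, hi, rfl⟩
    simp only [r, dif_pos h]
    exact congrArg _ (hv _ h.choose_spec.1 _ hi h.choose_spec.2)
  have hr' : ∀ x, (∀ i ∈ s, v i ≠ x) → r x = none := by
    intro x hx
    exact dif_neg fun ⟨i, hi, h⟩ => hx i hi h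
  let op : Option X → Option X → Option X := fun p q =>
    p.elim (q.elim none r) fun x => q.elim (r x) fun y => some (fop x y)
  obtain ⟨B, _, g, hB, hg, hop⟩ := exists_model_of_op hT0 op
  refine ⟨B, _, g ∘ some, g none, hB, hg.comp (Option.some_injective _), fun x y => hop (some x) (some y),
    fun i hi => ?_⟩
  have hc : ![g none, (g ∘ some) (u i), (g ∘ some) (v i)] =
      g ∘ ![none, some (u i), some (v i)] := by
    funext k
    fin_cases k <;> rfl
  have hne : u i ≠ v i := fun h => by simpa using (huv i).injective (a₁ := 0) (a₂ := 1) h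
  have hu : r (u i) = none := hr' _ fun j hj => hvu j hj i hi
  have hm : ∀ m : S, r m = none := fun m => hr' _ fun j _ h => (huv j).ne m 1 h.symm
  rw [hc]
  refine ⟨hg.comp ?_, fun m k => hg.ne ?_, fun k k' => ?_, fun m k => ?_, fun m k => ?_⟩
  · intro k k' h
    fin_cases k <;> fin_cases k' <;> simp_all
  · fin_cases k
    · simp
    · exact (Option.some_injective _).ne ((huv i).ne m 0)
    · exact (Option.some_injective _).ne ((huv i).ne m 1)
  · refine (hop _ _).symm.trans (congrArg g ?_)
    fin_cases k <;> fin_cases k'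
    · rfl
    · exact hu
    · exact hr i hi
    · exact hu
    · exact congrArg _ ((huv i).op 0 0)
    · exact congrArg _ ((huv i).op 0 1)
    · exact hr i hi
    · exact congrArg _ ((huv i).op 1 0)
    · exact congrArg _ ((huv i).op 1 1)
  · refine (hop _ _).symm.trans (congrArg g ?_)
    fin_cases k
    · exact hm m
    · exact congrArg _ ((huv i).op_left m 0)
    · exact congrArg _ ((huv i).op_left m 1)
  · refine (hop _ _).symm.trans (congrArg g ?_)
    fin_cases k
    · exact hm m
    · exact congrArg _ ((huv i).op_right m 0)
    · exact congrArg _ ((huv i).op_right m 1)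

theorem dind_of_isPattern (hT0 : IsModelCompletionOfEmptyTheory.{u} T0)
    (hX : T0.Model X) (e : (X ⊕ Sym2 X) ≃[L12] N) (R : L12.ElementarySubstructure N)
    {κ : Cardinal.{w}} (hN : IsMonster L12 N κ) (hR : #(R : Set N) < κ) {x x₁ x₂ : X}
    (hx : IsPattern ((↑) : homeSet e R → X) tripleTable ![x, x₁, x₂])
    (hx12 : IsPattern ((↑) : homeSet e R → X) (fun k _ => k) ![x₁, x₂]) :
    dind L12 N {e (Sum.inl x)} R {e (Sum.inr s(x₁, x₂))} := by
  rintro ⟨m, φ, b, hb, hφ, bs, k, -, rfl, hind, hincons⟩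
  choose σ hσR hσ using hind.exists_equiv hN hR
  choose D hD hDpat using fun i => hx12.map_equiv (hσR i)
  have hDne : ∀ i, D i 0 ≠ D i 1 := fun i h => by simpa using (hDpat i).injective h
  obtain ⟨s, u, v, hs, huv, hvu, hv⟩ := exists_orientation (D · 0) (D · 1) hDne k
  have huvpat : ∀ i, IsPattern ((↑) : homeSet e R → X) (fun k _ => k) ![u i, v i] := by
    intro i
    rcases huv i with ⟨h, h'⟩ | ⟨h, h'⟩
    · convert hDpat i using 1
      funext k
      fin_cases k <;> assumption
    · convert (hDpat i).comp (Equiv.swap (0 : Fin 2) 1).injective using 1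
      funext k
      fin_cases k
      · exact h
      · exact h'
  obtain ⟨B, _, g, z, hB, hg, hop, hpat⟩ := exists_extension_isPattern hT0 huvpat hvu hv
  have hσb : ∀ i, σ i (e (Sum.inr s(x₁, x₂))) = e (Sum.inr s(u i, v i)) := by
    intro i
    have h1 : p12Q (e (Sum.inl x₁)) (e (Sum.inl x₂)) (e (Sum.inr s(x₁, x₂))) :=
      (p12Q_equiv e _ _ _).2 rfl
    rw [← p12Q_map (σ i)] at h1
    have h2 : σ i (e (Sum.inl x₁)) = e (Sum.inl (D i 0)) := hD i 0
    have h3 : σ i (e (Sum.inl x₂)) = e (Sum.inl (D i 1)) := hD i 1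
    rw [h2, h3, p12Q_equiv] at h1
    rw [h1]
    rcases huv i with ⟨h, h'⟩ | ⟨h, h'⟩
    · rw [h, h']
    · rw [h, h', Sym2.eq_swap]
  let G : N → B ⊕ Sym2 B := mapPairs g ∘ e.symm
  have hrep : ∀ j, ∃ t : (homeSet e R ⊕ Fin 3) ⊕ Sym2 (homeSet e R ⊕ Fin 3),
      bs 0 j = e (mapPairs (Sum.elim (↑) ![x, x₁, x₂]) t) ∧ ∀ i, G (bs i j) =
        mapPairs (Sum.elim (fun y : homeSet e R => g y) ![z, g (u i), g (v i)]) t := by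
    intro j
    rcases hb j with h | h
    · refine ⟨Sum.inr s(Sum.inr 1, Sum.inr 2), h, fun i => ?_⟩
      have h : bs 0 j = e (Sum.inr s(x₁, x₂)) := h
      rw [← hσ, h, hσb]
      simp [G]
    · obtain ⟨t, ht⟩ := exists_mapPairs_eq e R h
      refine ⟨mapPairs Sum.inl t, ?_, fun i => ?_⟩
      · rw [ht]
        rcases t with y | q
        · rfl
        · induction q with
          | _ y y' => rfl
      · rw [← hσ, hσR i _ h, ht]
        simp only [G, Function.comp_apply, FirstOrder.Language.Equiv.symm_apply_apply]
        rcases t with y | q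
        · rfl
        · induction q with
          | _ y y' => rfl
  choose t ht htG using hrep
  let χ : L12.Formula N := (Formula.iInf fun i : s => φ.relabel
    (Sum.elim Sum.inr (Sum.inl ∘ bs i))).iExs ({e (Sum.inl x)} : Set N)
  have hχ : χ.Realize G := by
    simp only [χ, Formula.realize_iExs, Formula.realize_iInf, Formula.realize_relabel]
    refine ⟨fun _ => Sum.inl z, fun i => ?_⟩
    have h1 : Sum.elim G (fun _ => Sum.inl z) ∘ Sum.elim Sum.inr (Sum.inl ∘ bs i) =
        mapPairs (Sum.elim (fun y : homeSet e R => g y) ![z, g (u i), g (v i)]) ∘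
          Sum.elim (fun _ : ({e (Sum.inl x)} : Set N) => Sum.inl (Sum.inr 0)) t := by
      funext j
      rcases j with j | j
      · rfl
      · exact htG j i
    have h2 : Sum.elim (fun y : ({e (Sum.inl x)} : Set N) => (y : N)) (bs 0) =
        e ∘ mapPairs (Sum.elim ((↑) : homeSet e R → X) ![x, x₁, x₂]) ∘
          Sum.elim (fun _ : ({e (Sum.inl x)} : Set N) => Sum.inl (Sum.inr 0)) t := by
      funext j
      rcases j with j | j
      · exact j.2
      · exact ht j
    rw [h2, StrongHomClass.realize_formula] at hφ
    rw [h1]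
    let op : homeSet e R → homeSet e R → homeSet e R := fun x y =>
      ⟨fop x.1 y.1, fop_mem_homeSet e R x.2 y.2⟩
    exact (IsPattern.realize_iff hT0 hX hB (op := op) Subtype.val_injective
      (hg.comp Subtype.val_injective) (fun _ _ => rfl) (fun x y => hop x.1 y.1) hx (hpat i i.2)
      φ _).1 hφ
  rw [realize_extension_iff hT0 hX hB e hg hop] at hχ
  simp only [χ, Formula.realize_iExs, Formula.realize_iInf, Formula.realize_relabel] at hχ
  obtain ⟨y, hy⟩ := hχ
  refine hincons s hs ⟨y, fun i hi => ?_⟩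
  convert hy ⟨i, hi⟩ using 1
  funext j
  rcases j with j | j <;> rfl

end Dividing

section Forking

variable {T0 : Lf.Theory} {X N : Type w} [Lf.Structure X] [L12.Structure N]

theorem typeForksOver_of_isPattern (hT0 : IsModelCompletionOfEmptyTheory.{u} T0)
    (hX : T0.Model X) (e : (X ⊕ Sym2 X) ≃[L12] N) (R : L12.ElementarySubstructure N)
    {κ : Cardinal.{w}} (hN : IsMonster L12 N κ) (hR : #(R : Set N) < κ) {x₁ x₂ : X}
    (hx12 : IsPattern ((↑) : homeSet e R → X) (fun k _ => k) ![x₁, x₂])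
    (hx21 : IsPattern ((↑) : homeSet e R → X) (fun k _ => k) ![x₂, x₁])
    {ι : Type*} {a : ι → N} (t : ι) (ha : p12F (a t) (e (Sum.inl x₂)) (e (Sum.inl x₁))) :
    TypeForksOver L12 N R ({e (Sum.inr s(x₁, x₂))} ∪ R) a := by
  refine ⟨2, fun _ => 2, fun _ => fmF (Sum.inl t) (Sum.inr 1) (Sum.inr 0),
    ![![e (Sum.inl x₁), e (Sum.inl x₂)], ![e (Sum.inl x₂), e (Sum.inl x₁)] ], ?_, ?_⟩
  · intro j
    fin_cases j
    · exact formulaDividesOver_of_isPattern hT0 hX e R hN hR hx12 t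
    · exact formulaDividesOver_of_isPattern hT0 hX e R hN hR hx21 t
  · intro y hy
    let χ : L12.Formula (ι ⊕ Fin 1) :=
      (fmQ (Sum.inr 0) (Sum.inr 1) (Sum.inl (Sum.inr 0)) ⊓
        fmF (Sum.inl (Sum.inl t)) (Sum.inr 1) (Sum.inr 0) :
        L12.Formula ((ι ⊕ Fin 1) ⊕ Fin 2)).iExs (Fin 2)
    have hχ : ∀ y : ι → N, χ.Realize (Sum.elim y fun _ => e (Sum.inr s(x₁, x₂))) ↔
        ∃ z : Fin 2 → N, p12Q (z 0) (z 1) (e (Sum.inr s(x₁, x₂))) ∧ p12F (y t) (z 1) (z 0) := by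
      intro y
      simp only [χ, Formula.realize_iExs, Formula.realize_inf, realize_fmQ, realize_fmF]
      rfl
    obtain ⟨z, hz, hz'⟩ := (hχ y).1 <| (hy 1 χ _ fun _ => Or.inl rfl).2 <| (hχ a).2
      ⟨![e (Sum.inl x₁), e (Sum.inl x₂)], (p12Q_equiv e x₁ x₂ _).2 rfl, ha⟩
    obtain ⟨u, v, h1, h2, h3⟩ := (p12Q_iff_exists e _ _ _).1 hz
    rw [h1, h2] at hz'
    rcases Sym2.eq_iff.1 (Sum.inr_injective (e.injective h3)) with ⟨rfl, rfl⟩ | ⟨rfl, rfl⟩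
    · exact ⟨0, (realize_fmF _ _ _ _).2 hz'⟩
    · exact ⟨1, (realize_fmF _ _ _ _).2 hz'⟩

end Forking

/-- Let `T^eq_f` be the imaginary expansion of the model completion `T^∅_f`
of the empty theory in the language with a single binary function symbol `f`.  In a monster
model, let `M` be a small model, let `d₁ ≠ d₂` be home-sort elements not in `M` with
`f(dᵢ,dⱼ) = dᵢ` and `f(m,dₖ) = f(dₖ,m) = dₖ` for `m ∈ M`, let `b = q(d₁,d₂)`, and let `a` be
a home-sort element with `f(a,a) = a`, `f(a,m) = f(m,a) = a` for `m ∈ M`,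
`f(a,d₁) = f(d₁,a) = a`, and `f(a,d₂) = f(d₂,a) = d₁`.  Then `a ⫝d_M b`, but neither
`a ⫝M_M b` nor `a ⫝d_M acl(Mb)`; in particular dividing independence implies neither
M-independence nor forking independence, even over a model. -/
theorem generic_binary_function_counterexample
    (T0 : Lf.Theory) (hT0 : IsModelCompletionOfEmptyTheory T0)
    (M₀ : Type w) [Lf.Structure M₀] (hM₀ : T0.Model M₀)
    (N : Type w) [L12.Structure N] [(T12 M₀).Model N]
    (κ : Cardinal.{w}) (hN : IsMonster L12 N κ)
    (Msub : L12.ElementarySubstructure N) (hsmall : #(Msub : Set N) < κ)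
    (d₁ d₂ a b : N)
    (hd₁O : p12O d₁) (hd₂O : p12O d₂) (haO : p12O a)
    (hne : d₁ ≠ d₂) (hd₁M : d₁ ∉ Msub) (hd₂M : d₂ ∉ Msub)
    (hf11 : p12F d₁ d₁ d₁) (hf12 : p12F d₁ d₂ d₁) (hf21 : p12F d₂ d₁ d₂) (hf22 : p12F d₂ d₂ d₂)
    (hfM : ∀ m ∈ Msub, p12O m →
      p12F m d₁ d₁ ∧ p12F d₁ m d₁ ∧ p12F m d₂ d₂ ∧ p12F d₂ m d₂)
    (hb : p12Q d₁ d₂ b)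
    (haa : p12F a a a)
    (haM : ∀ m ∈ Msub, p12O m → p12F a m a ∧ p12F m a a)
    (had₁ : p12F a d₁ a ∧ p12F d₁ a a)
    (had₂ : p12F a d₂ d₁ ∧ p12F d₂ a d₁) :
    dind L12 N {a} (Msub : Set N) {b} ∧
      ¬Mind L12 N {a} (Msub : Set N) {b} ∧
      ¬dind L12 N {a} (Msub : Set N) (acl L12 N ((Msub : Set N) ∪ {b})) ∧
      ¬find L12 N {a} (Msub : Set N) {b} := by
  obtain ⟨X, _, hX, ⟨e⟩⟩ := exists_model_equiv hM₀ N
  obtain ⟨x₁, rfl⟩ := (p12O_equiv e d₁).1 hd₁O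
  obtain ⟨x₂, rfl⟩ := (p12O_equiv e d₂).1 hd₂O
  obtain ⟨x, rfl⟩ := (p12O_equiv e a).1 haO
  obtain rfl := (p12Q_equiv e x₁ x₂ b).1 hb
  have hFM : ∀ m : homeSet e Msub, fop (m : X) x₁ = x₁ ∧ fop x₁ m = x₁ ∧ fop (m : X) x₂ = x₂ ∧
      fop x₂ m = x₂ := fun m => by
    simpa only [p12F_equiv] using hfM _ m.2 ((p12O_equiv e _).2 ⟨_, rfl⟩)
  have hAM : ∀ m : homeSet e Msub, fop x m = x ∧ fop (m : X) x = x := fun m => by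
    simpa only [p12F_equiv] using haM _ m.2 ((p12O_equiv e _).2 ⟨_, rfl⟩)
  have haF := had₂.1
  simp only [p12F_equiv] at hf11 hf12 hf21 hf22 haa had₁ had₂
  have hx12ne : x₁ ≠ x₂ := fun h => hne (by rw [h])
  have hx1 : x ≠ x₁ := by
    rintro rfl
    exact hx12ne (had₂.2.symm.trans hf21)
  have hx2 : x ≠ x₂ := by
    rintro rfl
    exact hx12ne (had₂.2.symm.trans hf22)
  have hm1 : ∀ m : homeSet e Msub, (m : X) ≠ x₁ := fun m h => hd₁M (h ▸ m.2)
  have hm2 : ∀ m : homeSet e Msub, (m : X) ≠ x₂ := fun m h => hd₂M (h ▸ m.2)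
  have hm : ∀ m : homeSet e Msub, (m : X) ≠ x := by
    rintro m rfl
    exact hx12ne (had₂.1.symm.trans (hFM m).2.2.1)
  have hx12 : IsPattern ((↑) : homeSet e Msub → X) (fun k _ => k) ![x₁, x₂] := by
    refine ⟨fun k k' h => ?_, fun m k => ?_, fun k k' => ?_, fun m k => ?_, fun m k => ?_⟩
    · fin_cases k <;> fin_cases k' <;> simp_all
    · fin_cases k
      exacts [hm1 m, hm2 m]
    · fin_cases k <;> fin_cases k' <;> assumption
    · fin_cases k
      exacts [(hFM m).1, (hFM m).2.2.1]
    · fin_cases k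
      exacts [(hFM m).2.1, (hFM m).2.2.2]
  have hx21 : IsPattern ((↑) : homeSet e Msub → X) (fun k _ => k) ![x₂, x₁] := by
    convert hx12.comp (Equiv.swap (0 : Fin 2) 1).injective using 1
    funext k
    fin_cases k <;> rfl
  have hx : IsPattern ((↑) : homeSet e Msub → X) tripleTable ![x, x₁, x₂] := by
    refine ⟨fun k k' h => ?_, fun m k => ?_, fun k k' => ?_, fun m k => ?_, fun m k => ?_⟩
    · fin_cases k <;> fin_cases k' <;> simp_all
    · fin_cases k
      exacts [hm m, hm1 m, hm2 m]
    · fin_cases k <;> fin_cases k'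
      exacts [haa, had₁.1, had₂.1, had₁.2, hf11, hf12, had₂.2, hf21, hf22]
    · fin_cases k
      exacts [(hAM m).2, (hFM m).1, (hFM m).2.2.1]
    · fin_cases k
      exacts [(hAM m).1, (hFM m).2.1, (hFM m).2.2.2]
  have hd₁ : ∀ C : Set N, e (Sum.inr s(x₁, x₂)) ∈ C → e (Sum.inl x₁) ∈ acl L12 N C :=
    fun C h => mem_acl_of_p12Q e h
  have hd₂ : ∀ C : Set N, e (Sum.inr s(x₁, x₂)) ∈ C → e (Sum.inl x₂) ∈ acl L12 N C :=
    fun C h => mem_acl_of_p12Q e (y := x₁) (by rwa [Sym2.eq_swap])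
  refine ⟨dind_of_isPattern hT0 hX e Msub hN hsmall hx hx12, fun h => ?_, fun h => ?_, fun h => ?_⟩
  · refine not_mem_acl_of_isPattern hT0 hX e Msub hN hsmall hx12 ?_
    rw [← h (Msub ∪ {e (Sum.inl x₂)}) subset_union_left (union_subset
      (subset_union_right.trans (subset_acl _)) (singleton_subset_iff.2 (hd₂ _ (Or.inl rfl))))]
    refine ⟨?_, hd₁ _ (Or.inl rfl)⟩
    rw [← had₂.1]
    exact mem_acl_of_p12F e (Or.inl rfl) (Or.inr (Or.inr rfl))
  · refine h ⟨2, fmF (Sum.inl ⟨_, rfl⟩) (Sum.inr 1) (Sum.inr 0),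
      ![e (Sum.inl x₁), e (Sum.inl x₂)], fun i => Or.inl ?_, (realize_fmF _ _ _ _).2 haF,
      formulaDividesOver_of_isPattern hT0 hX e Msub hN hsmall hx12 _⟩
    fin_cases i
    exacts [hd₁ _ (Or.inr rfl), hd₂ _ (Or.inr rfl)]
  · exact h (typeForksOver_of_isPattern hT0 hX e Msub hN hsmall hx12 hx21 ⟨_, rfl⟩ haF)

end PaperDiv
end
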